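/- For every integer n ≥ 3 there exist a Ważewski dendrite X of order n and a finitely generated subgroup G of Homeo(X) such that the commutator subgroup [G,G] is dense in Homeo(X). -/

import Mathlib

open Topology

/-- The set of connected components of a subset `S` of `X`. -/
def setComponents (X : Type*) [TopologicalSpace X] (S : Set X) : Set (Set X) :=
  {C | ∃ x ∈ S, C = connectedComponentIn S x}

/-- The order of a point `p` of `X`: the number of connected components of `X \ {p}`. -/
noncomputable def ptOrder (X : Type*) [TopologicalSpace X] (p : X) : ℕ :=
  (setComponents X {p}ᶜ).ncard

/-- A dendrite: a nonempty, compact, connected, locally connected metrizable space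
containing no subspace homeomorphic to the circle. -/
def IsDendrite (X : Type*) [TopologicalSpace X] : Prop :=
  Nonempty X ∧ CompactSpace X ∧ ConnectedSpace X ∧ LocallyConnectedSpace X ∧
    TopologicalSpace.MetrizableSpace X ∧
    ∀ S : Set X, IsEmpty (S ≃ₜ Circle)

/-- A Ważewski dendrite of order `n`: a dendrite all of whose points have order `1`, `2`
or `n`, and every arc (subspace homeomorphic to `[0,1]`) contains a point of order `n`. -/
def IsWazewskiDendrite (n : ℕ) (X : Type*) [TopologicalSpace X] : Prop :=
  IsDendrite X ∧
  (∀ p : X, ptOrder X p = 1 ∨ ptOrder X p = 2 ∨ ptOrder X p = n) ∧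
  ∀ A : Set X, Nonempty (A ≃ₜ unitInterval) → ∃ p ∈ A, ptOrder X p = n

/-- The group structure on self-homeomorphisms of `X`, with composition as product. -/
instance Homeomorph.instGroupSelf (X : Type*) [TopologicalSpace X] : Group (X ≃ₜ X) where
  mul f g := g.trans f
  one := Homeomorph.refl X
  inv := Homeomorph.symm
  mul_assoc _ _ _ := rfl
  one_mul _ := Homeomorph.ext fun _ => rfl
  mul_one _ := Homeomorph.ext fun _ => rfl
  inv_mul_cancel := Homeomorph.self_trans_symm

/-- The compact-open topology on the group of self-homeomorphisms of `X` (for compact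
metric `X`, this is the topology of uniform convergence). -/
instance Homeomorph.instTopSelf (X : Type*) [TopologicalSpace X] :
    TopologicalSpace (X ≃ₜ X) :=
  TopologicalSpace.induced (fun h : X ≃ₜ X => (h : C(X, X))) ContinuousMap.compactOpen

set_option linter.unusedSectionVars false

/-! ### Self-similar structure -/

/-- A compact metric space which is a wedge of `m + 3` half-size copies of itself. -/
structure SelfSim (m : ℕ) (X : Type) [MetricSpace X] where
  f : Fin (m + 3) → X → X
  a : X
  b : X
  c : X
  inj : ∀ i, Function.Injective (f i)
  lip : ∀ i x y, dist (f i x) (f i y) ≤ dist x y / 2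
  fb : ∀ i, f i b = c
  f0a : f 0 a = a
  f1a : f 1 a = b
  ab : a ≠ b
  cover : ∀ x, ∃ i y, x = f i y
  inter : ∀ i j x y, i ≠ j → f i x = f j y → x = b

namespace Model

/-- The affine maps in the plane. -/
noncomputable def F (m : ℕ) (i : Fin (m + 3)) (p : ℝ × ℝ) : ℝ × ℝ :=
  if i.val = 0 then ((p.1 - 1) / 2, p.2 / (16 * (m + 3)))
  else if i.val = 1 then ((1 - p.1) / 2, p.2 / (16 * (m + 3)))
  else (i.val / (4 * (m + 3)) * (1 - p.1) + p.2 / (16 * (m + 3)), (1 - p.1) / (4 * (m + 3)))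

/-- The invariant rhombus. -/
def Q : Set (ℝ × ℝ) := {p | |p.2| ≤ 1 - |p.1|}

lemma idx (m : ℕ) (i : Fin (m + 3)) : (i.val : ℝ) ≤ (m : ℝ) + 2 := by
  have := i.isLt
  have h : i.val ≤ m + 2 := by omega
  exact_mod_cast h

lemma F_inj (m : ℕ) (i : Fin (m + 3)) : Function.Injective (F m i) := by
  rintro ⟨u, v⟩ ⟨u', v'⟩ h
  have hm : (0 : ℝ) < (m : ℝ) + 3 := by positivity
  have hm' : (m : ℝ) + 3 ≠ 0 := hm.ne'
  unfold F at h
  split_ifs at h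
  · simp only [Prod.mk.injEq] at h ⊢
    obtain ⟨h1, h2⟩ := h
    field_simp at h2
    exact ⟨by linarith, h2⟩
  · simp only [Prod.mk.injEq] at h ⊢
    obtain ⟨h1, h2⟩ := h
    field_simp at h2
    exact ⟨by linarith, h2⟩
  · simp only [Prod.mk.injEq] at h ⊢
    obtain ⟨h1, h2⟩ := h
    field_simp at h2
    have : u = u' := by linarith
    subst this
    refine ⟨rfl, ?_⟩
    have h3 := add_left_cancel h1
    field_simp at h3
    exact h3

lemma F_lip (m : ℕ) (i : Fin (m + 3)) (p q : ℝ × ℝ) :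
    dist (F m i p) (F m i q) ≤ dist p q / 2 := by
  obtain ⟨u, v⟩ := p
  obtain ⟨u', v'⟩ := q
  have hm : (0 : ℝ) ≤ (m : ℝ) := by positivity
  set D := dist (u, v) (u', v') with hD
  have h1 : |u - u'| ≤ D := by
    rw [hD, Prod.dist_eq]; exact le_max_left _ _
  have h2 : |v - v'| ≤ D := by
    rw [hD, Prod.dist_eq]; exact le_max_right _ _
  have hD0 : 0 ≤ D := dist_nonneg
  have e : ∀ x y : ℝ, |x / (16 * ((m : ℝ) + 3)) - y / (16 * ((m : ℝ) + 3))| ≤ |x - y| / 16 := by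
    intro x y
    rw [← sub_div, abs_div, abs_of_pos (by positivity : (0 : ℝ) < 16 * ((m : ℝ) + 3))]
    gcongr
    linarith
  have ev := e v v'
  unfold F
  split_ifs
  · rw [Prod.dist_eq]
    apply max_le
    · simp only [Real.dist_eq]
      rw [show (u - 1) / 2 - (u' - 1) / 2 = (u - u') / 2 by ring, abs_div, abs_two]
      linarith
    · simp only [Real.dist_eq]
      linarith
  · rw [Prod.dist_eq]
    apply max_le
    · simp only [Real.dist_eq]
      rw [show (1 - u) / 2 - (1 - u') / 2 = -((u - u') / 2) by ring, abs_neg, abs_div, abs_two]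
      linarith
    · simp only [Real.dist_eq]
      linarith
  · have hi := idx m i
    have hi0 : (0 : ℝ) ≤ i.val := by positivity
    have hk : (i.val : ℝ) / (4 * (m + 3)) ≤ 1 / 4 := by
      rw [div_le_div_iff₀ (by positivity) (by positivity)]
      linarith
    have hk0 : 0 ≤ (i.val : ℝ) / (4 * (m + 3)) := by positivity
    set k := (i.val : ℝ) / (4 * (m + 3))
    rw [Prod.dist_eq]
    apply max_le
    · simp only [Real.dist_eq]
      have : |k * (1 - u) + v / (16 * ((m : ℝ) + 3)) - (k * (1 - u') + v' / (16 * ((m : ℝ) + 3)))|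
          ≤ |k * (u' - u)| + |v / (16 * ((m : ℝ) + 3)) - v' / (16 * ((m : ℝ) + 3))| := by
        refine le_trans (le_of_eq ?_) (abs_add_le _ _)
        congr 1; ring
      rw [abs_mul, abs_of_nonneg hk0, abs_sub_comm] at this
      have h3 : k * |u - u'| ≤ 1 / 4 * D := by
        apply mul_le_mul hk h1 (abs_nonneg _) (by norm_num)
      rw [abs_sub_comm u' u] at this
      rw [abs_sub_comm] at this
      linarith
    · simp only [Real.dist_eq]
      rw [← sub_div, abs_div, abs_of_pos (by positivity : (0 : ℝ) < 4 * ((m : ℝ) + 3)),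
        show 1 - u - (1 - u') = -(u - u') by ring, abs_neg, div_le_iff₀ (by positivity)]
      nlinarith

lemma F_Q (m : ℕ) (i : Fin (m + 3)) (p : ℝ × ℝ) (hp : p ∈ Q) : F m i p ∈ Q := by
  obtain ⟨u, v⟩ := p
  have hm : (0 : ℝ) ≤ (m : ℝ) := by positivity
  simp only [Q, Set.mem_ofPred_eq] at hp
  have hv : |v / (16 * ((m : ℝ) + 3))| ≤ |v| / 16 := by
    rw [abs_div, abs_of_pos (by positivity : (0 : ℝ) < 16 * ((m : ℝ) + 3))]
    gcongr
    linarith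
  have hv0 := abs_nonneg v
  have hu : -1 ≤ u ∧ u ≤ 1 := abs_le.mp (by linarith)
  obtain ⟨hu1, hu2⟩ := hu
  have a1 := le_abs_self u
  have a2 := neg_abs_le u
  unfold F Q
  split_ifs
  · simp only [Set.mem_ofPred_eq]
    rw [abs_of_nonpos (by linarith : (u - 1) / 2 ≤ 0)]
    linarith
  · simp only [Set.mem_ofPred_eq]
    rw [abs_of_nonneg (by linarith : 0 ≤ (1 - u) / 2)]
    linarith
  · have hi := idx m i
    have hi0 : (0 : ℝ) ≤ i.val := by positivity
    have hk : (i.val : ℝ) / (4 * (m + 3)) ≤ 1 / 4 := by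
      rw [div_le_div_iff₀ (by positivity) (by positivity)]
      linarith
    have hk0 : 0 ≤ (i.val : ℝ) / (4 * (m + 3)) := by positivity
    set k := (i.val : ℝ) / (4 * (m + 3))
    simp only [Set.mem_ofPred_eq]
    have h1 : |(1 - u) / (4 * ((m : ℝ) + 3))| ≤ (1 - u) / 12 := by
      rw [abs_of_nonneg (div_nonneg (by linarith) (by positivity))]
      apply div_le_div_of_nonneg_left (by linarith) (by norm_num) (by linarith)
    have h2 := abs_add_le (k * (1 - u)) (v / (16 * ((m : ℝ) + 3)))
    have h3 : |k * (1 - u)| ≤ 1 / 4 * (1 - u) := by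
      rw [abs_of_nonneg (mul_nonneg hk0 (by linarith))]
      apply mul_le_mul_of_nonneg_right hk (by linarith)
    linarith

/-- Cone description of the pieces. -/
lemma F_cone0 (m : ℕ) (i : Fin (m + 3)) (h : i.val = 0) (p : ℝ × ℝ) (hp : p ∈ Q) :
    (F m i p).1 ≤ 0 ∧ |(F m i p).2| ≤ - (F m i p).1 / (8 * (m + 3)) := by
  obtain ⟨u, v⟩ := p
  simp only [Q, Set.mem_ofPred_eq] at hp
  have hm : (0 : ℝ) ≤ (m : ℝ) := by positivity
  have a1 := le_abs_self u
  have hv0 := abs_nonneg v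
  simp only [F, h, if_true]
  refine ⟨by linarith, ?_⟩
  rw [abs_div, abs_of_pos (by positivity : (0 : ℝ) < 16 * ((m : ℝ) + 3)),
    div_le_div_iff₀ (by positivity) (by positivity)]
  nlinarith

lemma F_cone1 (m : ℕ) (i : Fin (m + 3)) (h : i.val = 1) (p : ℝ × ℝ) (hp : p ∈ Q) :
    0 ≤ (F m i p).1 ∧ |(F m i p).2| ≤ (F m i p).1 / (8 * (m + 3)) := by
  obtain ⟨u, v⟩ := p
  simp only [Q, Set.mem_ofPred_eq] at hp
  have hm : (0 : ℝ) ≤ (m : ℝ) := by positivity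
  have a1 := le_abs_self u
  have hv0 := abs_nonneg v
  have : F m i (u, v) = ((1 - u) / 2, v / (16 * (m + 3))) := by
    simp [F, h]
  rw [this]
  refine ⟨by simp only; linarith, ?_⟩
  simp only
  rw [abs_div, abs_of_pos (by positivity : (0 : ℝ) < 16 * ((m : ℝ) + 3)),
    div_le_div_iff₀ (by positivity) (by positivity)]
  nlinarith

lemma F_cone2 (m : ℕ) (i : Fin (m + 3)) (h0 : i.val ≠ 0) (h : i.val ≠ 1) (p : ℝ × ℝ)
    (hp : p ∈ Q) :
    0 ≤ (F m i p).2 ∧ |(F m i p).1 - i.val * (F m i p).2| ≤ (F m i p).2 / 4 := by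
  obtain ⟨u, v⟩ := p
  simp only [Q, Set.mem_ofPred_eq] at hp
  have hm : (0 : ℝ) ≤ (m : ℝ) := by positivity
  have a1 := le_abs_self u
  have hv0 := abs_nonneg v
  simp only [F, h0, h, if_false]
  refine ⟨div_nonneg (by linarith) (by positivity), ?_⟩
  rw [show (i.val : ℝ) / (4 * ((m : ℝ) + 3)) * (1 - u) + v / (16 * ((m : ℝ) + 3)) -
    i.val * ((1 - u) / (4 * ((m : ℝ) + 3))) = v / (16 * ((m : ℝ) + 3)) by ring]
  rw [abs_div, abs_of_pos (by positivity : (0 : ℝ) < 16 * ((m : ℝ) + 3)), div_div,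
    div_le_div_iff₀ (by positivity) (by positivity)]
  nlinarith

lemma cone_zero {k x y : ℝ} (hk : 24 ≤ k) (h1 : |y| ≤ |x| / k)
    (h2 : |x| ≤ (k / 8) * |y|) : x = 0 ∧ y = 0 := by
  have hx : |x| / k * k = |x| := by field_simp
  have h3 : |x| = 0 := by
    have := abs_nonneg x
    have := abs_nonneg y
    nlinarith
  rw [h3] at h1
  simp only [zero_div] at h1
  exact ⟨abs_eq_zero.mp h3, abs_eq_zero.mp (le_antisymm h1 (abs_nonneg _))⟩

lemma F_sep_aux (m : ℕ) (i j : Fin (m + 3)) (hij : i.val < j.val) (p q : ℝ × ℝ)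
    (hp : p ∈ Q) (hq : q ∈ Q) (h : F m i p = F m j q) : F m i p = (0, 0) := by
  have hm : (0 : ℝ) ≤ (m : ℝ) := by positivity
  have hj := idx m j
  have hi := idx m i
  rcases Nat.lt_or_ge j.val 2 with h2 | h2
  · have c0 := F_cone0 m i (by omega) p hp
    have c1 := F_cone1 m j (by omega) q hq
    rw [← h] at c1
    have e : (F m i p).1 = 0 := le_antisymm c0.1 c1.1
    have e2 := c1.2
    rw [e, zero_div] at e2
    exact Prod.ext e (abs_eq_zero.mp (le_antisymm e2 (abs_nonneg _)))
  · have cj := F_cone2 m j (by omega) (by omega) q hq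
    rw [← h] at cj
    rcases Nat.lt_or_ge i.val 2 with hi2 | hi2
    · have key : |(F m i p).2| ≤ |(F m i p).1| / (8 * (m + 3)) := by
        rcases Nat.lt_or_ge i.val 1 with hi1 | hi1
        · have c0 := F_cone0 m i (by omega) p hp
          rw [abs_of_nonpos c0.1]; exact c0.2
        · have c0 := F_cone1 m i (by omega) p hp
          rw [abs_of_nonneg c0.1]; exact c0.2
      have := cone_zero (k := 8 * ((m : ℝ) + 3)) (by linarith) key (by
        rw [abs_of_nonneg cj.1]
        have := abs_le.mp cj.2
        have hj0 : (0 : ℝ) ≤ j.val := by positivity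
        rw [abs_le]
        constructor <;> nlinarith [mul_nonneg hj0 cj.1, mul_nonneg (sub_nonneg.mpr hj) cj.1,
          cj.1])
      exact Prod.ext this.1 this.2
    · have ci := F_cone2 m i (by omega) (by omega) p hp
      have hlt : (i.val : ℝ) + 1 ≤ j.val := by exact_mod_cast hij
      have b1 := abs_le.mp ci.2
      have b2 := abs_le.mp cj.2
      have e : (F m i p).2 = 0 := by
        nlinarith [mul_le_mul_of_nonneg_right hlt ci.1, ci.1]
      rw [e] at b1
      exact Prod.ext (by linarith [b1.1, b1.2]) e

lemma F_sep (m : ℕ) (i j : Fin (m + 3)) (hij : i ≠ j) (p q : ℝ × ℝ)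
    (hp : p ∈ Q) (hq : q ∈ Q) (h : F m i p = F m j q) : F m i p = (0, 0) := by
  rcases lt_or_gt_of_ne (fun h => hij (Fin.ext h) : i.val ≠ j.val) with h1 | h1
  · exact F_sep_aux m i j h1 p q hp hq h
  · rw [h]; exact F_sep_aux m j i h1 q p hq hp h.symm

/-- Composition along a word. -/
noncomputable def W (m : ℕ) : List (Fin (m + 3)) → ℝ × ℝ
  | [] => (-1, 0)
  | i :: w => F m i (W m w)

/-- The underlying set of the dendrite. -/
def K (m : ℕ) : Set (ℝ × ℝ) := closure (Set.range (W m))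

lemma Q_closed : IsClosed Q := by
  unfold Q
  exact isClosed_le (by fun_prop) (by fun_prop)

lemma K_sub_Q (m : ℕ) : K m ⊆ Q := by
  apply closure_minimal _ Q_closed
  rintro _ ⟨w, rfl⟩
  induction w with
  | nil => simp [W, Q]
  | cons i w ih => exact F_Q m i _ ih

lemma K_compact (m : ℕ) : IsCompact (K m) := by
  have hQ : IsCompact Q := by
    apply Metric.isCompact_of_isClosed_isBounded Q_closed
    apply (Metric.isBounded_closedBall (x := ((0, 0) : ℝ × ℝ)) (r := 1)).subset
    rintro ⟨u, v⟩ h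
    simp only [Q, Set.mem_ofPred_eq] at h
    rw [Metric.mem_closedBall, Prod.dist_eq]
    simp only [Real.dist_eq, sub_zero]
    exact max_le (by linarith [abs_nonneg v]) (by linarith [abs_nonneg u])
  exact hQ.of_isClosed_subset isClosed_closure (K_sub_Q m)

lemma F_cont (m : ℕ) (i : Fin (m + 3)) : Continuous (F m i) := by
  unfold F
  split_ifs <;> fun_prop

lemma F_K (m : ℕ) (i : Fin (m + 3)) (p : ℝ × ℝ) (hp : p ∈ K m) : F m i p ∈ K m := by
  have : Set.MapsTo (F m i) (Set.range (W m)) (Set.range (W m)) := by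
    rintro _ ⟨w, rfl⟩
    exact ⟨i :: w, rfl⟩
  exact this.closure (F_cont m i) hp

lemma W0 (m : ℕ) : F m 0 (-1, 0) = (-1, 0) := by
  simp [F]; norm_num

lemma K_cover (m : ℕ) (p : ℝ × ℝ) (hp : p ∈ K m) : ∃ i, ∃ q ∈ K m, p = F m i q := by
  have hc : IsClosed (⋃ i, F m i '' K m) :=
    isClosed_iUnion_of_finite fun i => ((K_compact m).image (F_cont m i)).isClosed
  have hs : K m ⊆ ⋃ i, F m i '' K m := by
    apply closure_minimal _ hc
    rintro _ ⟨w, rfl⟩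
    rw [Set.mem_iUnion]
    cases w with
    | nil => exact ⟨0, _, subset_closure ⟨[], rfl⟩, W0 m⟩
    | cons i w => exact ⟨i, _, subset_closure ⟨w, rfl⟩, rfl⟩
  obtain ⟨i, q, hq, rfl⟩ := Set.mem_iUnion.mp (hs hp)
  exact ⟨i, q, hq, rfl⟩

lemma Fb (m : ℕ) (i : Fin (m + 3)) : F m i (1, 0) = (0, 0) := by
  unfold F; split_ifs <;> simp

lemma F1a (m : ℕ) : F m 1 (-1, 0) = (1, 0) := by
  simp [F]

lemma a_mem (m : ℕ) : ((-1, 0) : ℝ × ℝ) ∈ K m := subset_closure ⟨[], rfl⟩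
lemma b_mem (m : ℕ) : ((1, 0) : ℝ × ℝ) ∈ K m := by
  rw [← F1a m]; exact F_K m _ _ (a_mem m)
lemma c_mem (m : ℕ) : ((0, 0) : ℝ × ℝ) ∈ K m := by
  rw [← Fb m 0]; exact F_K m _ _ (b_mem m)

/-- The model is self-similar. -/
noncomputable def selfSim (m : ℕ) : SelfSim m (K m) where
  f i p := ⟨F m i p.1, F_K m i p.1 p.2⟩
  a := ⟨_, a_mem m⟩
  b := ⟨_, b_mem m⟩
  c := ⟨_, c_mem m⟩
  inj i p q h := Subtype.ext (F_inj m i (congrArg Subtype.val h))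
  lip i p q := F_lip m i p.1 q.1
  fb i := Subtype.ext (Fb m i)
  f0a := Subtype.ext (W0 m)
  f1a := Subtype.ext (F1a m)
  ab h := by
    have := congrArg (fun z : K m => z.1.1) h
    simp only at this
    norm_num at this
  cover p := by
    obtain ⟨i, q, hq, h⟩ := K_cover m p.1 p.2
    exact ⟨i, ⟨q, hq⟩, Subtype.ext h⟩
  inter i j p q hij h := by
    have h1 := F_sep m i j hij p.1 q.1 (K_sub_Q m p.2) (K_sub_Q m q.2) (congrArg Subtype.val h)
    apply Subtype.ext
    apply F_inj m i
    rw [h1, Fb]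

end Model

set_option linter.unusedSectionVars false

namespace SelfSim

variable {m : ℕ} {X : Type} [MetricSpace X] [CompactSpace X] (S : SelfSim m X)

lemma cont (i : Fin (m + 3)) : Continuous (S.f i) := by
  apply LipschitzWith.continuous (K := 1)
  apply LipschitzWith.of_dist_le_mul
  intro x y
  have := S.lip i x y
  have h0 : 0 ≤ dist x y := dist_nonneg
  simp only [NNReal.coe_one, one_mul]
  linarith

/-- The map attached to a word. -/
def fw : List (Fin (m + 3)) → X → X
  | [] => id
  | i :: w => S.f i ∘ fw w

lemma fw_cont (w : List (Fin (m + 3))) : Continuous (S.fw w) := by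
  induction w with
  | nil => exact continuous_id
  | cons i w ih => exact (S.cont i).comp ih

lemma fw_append (w v : List (Fin (m + 3))) (x : X) : S.fw (w ++ v) x = S.fw w (S.fw v x) := by
  induction w with
  | nil => rfl
  | cons i w ih => simp [fw, ih]

lemma fw_inj (w : List (Fin (m + 3))) : Function.Injective (S.fw w) := by
  induction w with
  | nil => exact Function.injective_id
  | cons i w ih => exact (S.inj i).comp ih

lemma fw_lip (w : List (Fin (m + 3))) (x y : X) :
    dist (S.fw w x) (S.fw w y) ≤ dist x y / 2 ^ w.length := by
  induction w with
  | nil => simp [fw]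
  | cons i w ih =>
    have := S.lip i (S.fw w x) (S.fw w y)
    simp only [fw, Function.comp, List.length_cons]
    calc _ ≤ _ := this
      _ ≤ (dist x y / 2 ^ w.length) / 2 := by linarith
      _ = _ := by rw [div_div, pow_succ]

lemma small {ε : ℝ} (hε : 0 < ε) : ∃ k : ℕ, ∀ w : List (Fin (m + 3)), k ≤ w.length →
    ∀ x y, dist (S.fw w x) (S.fw w y) < ε := by
  have hb : Bornology.IsBounded (Set.univ : Set X) := isCompact_univ.isBounded
  obtain ⟨D, hD⟩ := Metric.isBounded_iff.mp hb
  obtain ⟨k, hk⟩ := pow_unbounded_of_one_lt (D / ε) (by norm_num : (1 : ℝ) < 2)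
  refine ⟨k, fun w hw x y => ?_⟩
  have h1 := S.fw_lip w x y
  have h2 : dist x y ≤ D := hD (Set.mem_univ x) (Set.mem_univ y)
  have h3 : (2 : ℝ) ^ k ≤ 2 ^ w.length := pow_le_pow_right₀ (by norm_num) hw
  refine lt_of_le_of_lt h1 ?_
  rw [div_lt_iff₀ (by positivity)]
  rw [div_lt_iff₀ hε] at hk
  nlinarith

lemma addr (k : ℕ) (p : X) : ∃ w : List (Fin (m + 3)), w.length = k ∧ ∃ y, p = S.fw w y := by
  induction k generalizing p with
  | zero => exact ⟨[], rfl, p, rfl⟩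
  | succ k ih =>
    obtain ⟨i, y, rfl⟩ := S.cover p
    obtain ⟨w, hw, z, rfl⟩ := ih y
    exact ⟨i :: w, by simp [hw], z, rfl⟩

lemma precon (S : SelfSim m X) : PreconnectedSpace X := by
  apply preconnectedSpace_of_forall_constant
  intro χ hχ x y
  let g : X → ℝ := fun x => cond (χ x) 1 0
  have hg : Continuous g := (continuous_of_discreteTopology (f := fun b : Bool => cond b (1 : ℝ) 0)).comp hχ
  have hu := CompactSpace.uniformContinuous_of_continuous hg
  obtain ⟨δ, hδ, hd⟩ := Metric.uniformContinuous_iff.mp hu (1 / 2) (by norm_num)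
  have hc : ∀ x y, dist x y < δ → χ x = χ y := by
    intro x y hxy
    have := hd hxy
    simp only [g] at this
    cases h1 : χ x <;> cases h2 : χ y <;> simp [h1, h2, Real.dist_eq] at this ⊢ <;> norm_num at this
  obtain ⟨k, hk⟩ := S.small hδ
  have key : ∀ j, ∀ w : List (Fin (m + 3)), w.length + j = k →
      ∀ x y, χ (S.fw w x) = χ (S.fw w y) := by
    intro j
    induction j with
    | zero => exact fun w hw x y => hc _ _ (hk w (by omega) x y)
    | succ j ih =>
      intro w hw
      have h : ∀ x, χ (S.fw w x) = χ (S.fw w S.c) := by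
        intro x
        obtain ⟨i, z, rfl⟩ := S.cover x
        have := ih (w ++ [i]) (by simp; omega) z S.b
        rw [fw_append, fw_append] at this
        simpa [fw, S.fb] using this
      intro x y
      rw [h x, h y]
  exact key k [] (by simp) x y

/-- The cell of a word. -/
def cell (w : List (Fin (m + 3))) : Set X := Set.range (S.fw w)

lemma cell_precon (w : List (Fin (m + 3))) : IsPreconnected (S.cell w) := by
  have := S.precon
  exact isPreconnected_range (S.fw_cont w)

lemma cell_closed (w : List (Fin (m + 3))) : IsClosed (S.cell w) :=
  (isCompact_range (S.fw_cont w)).isClosed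

lemma locConn (S : SelfSim m X) : LocallyConnectedSpace X := by
  rw [locallyConnectedSpace_iff_connected_subsets]
  intro x U hU
  obtain ⟨ε, hε, hball⟩ := Metric.mem_nhds_iff.mp hU
  obtain ⟨k, hk⟩ := S.small hε
  have hfin : {w : List (Fin (m + 3)) | w.length = k}.Finite := List.finite_length_eq _ _
  refine ⟨⋃ w ∈ {w : List (Fin (m + 3)) | w.length = k ∧ x ∈ S.cell w}, S.cell w, ?_, ?_, ?_⟩
  · have ho : IsOpen (⋃ w ∈ {w : List (Fin (m + 3)) | w.length = k ∧ x ∉ S.cell w}, S.cell w)ᶜ := by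
      rw [isOpen_compl_iff]
      exact (hfin.subset (fun w hw => hw.1)).isClosed_biUnion (fun w _ => S.cell_closed w)
    refine Filter.mem_of_superset (ho.mem_nhds ?_) ?_
    · simp
    · intro y hy
      obtain ⟨w, hw, z, rfl⟩ := S.addr k y
      simp only [Set.mem_compl_iff, Set.mem_iUnion, not_exists] at hy
      simp only [Set.mem_iUnion]
      by_cases hx : x ∈ S.cell w
      · exact ⟨w, ⟨hw, hx⟩, z, rfl⟩
      · exact (hy w ⟨hw, hx⟩ ⟨z, rfl⟩).elim
  · rw [← Set.sUnion_image]
    apply isPreconnected_sUnion x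
    · rintro _ ⟨w, hw, rfl⟩; exact hw.2
    · rintro _ ⟨w, hw, rfl⟩; exact S.cell_precon w
  · refine Set.Subset.trans ?_ hball
    intro y hy
    simp only [Set.mem_iUnion] at hy
    obtain ⟨w, ⟨hw, ⟨z, hz⟩⟩, ⟨z', hz'⟩⟩ := hy
    rw [Metric.mem_ball, ← hz, ← hz']
    exact hk w hw.ge _ _

lemma inter_c {i j : Fin (m + 3)} {x y : X} (hij : i ≠ j) (h : S.f i x = S.f j y) :
    x = S.b ∧ y = S.b :=
  ⟨S.inter i j x y hij h, S.inter j i y x hij.symm h.symm⟩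

lemma c_ne_b : S.c ≠ S.b := by
  intro h
  rw [← S.f1a, ← S.fb 1] at h
  exact S.ab (S.inj 1 h).symm

lemma fw_c_ne_a (w : List (Fin (m + 3))) : S.fw w S.c ≠ S.a := by
  induction w with
  | nil =>
    intro h
    simp only [fw, id] at h
    rw [← S.f0a, ← S.fb 0] at h
    exact S.ab (S.inj 0 h).symm
  | cons i w ih =>
    intro h
    simp only [fw, Function.comp] at h
    rw [← S.f0a] at h
    by_cases hi : i = 0
    · subst hi; exact ih (S.inj 0 h)
    · exact S.ab (S.inter_c hi h).2

lemma fw_c_ne_b (w : List (Fin (m + 3))) : S.fw w S.c ≠ S.b := by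
  cases w with
  | nil => exact S.c_ne_b
  | cons i w =>
    intro h
    simp only [fw, Function.comp] at h
    rw [← S.f1a] at h
    by_cases hi : i = 1
    · subst hi; exact S.fw_c_ne_a w (S.inj 1 h)
    · exact S.ab (S.inter_c hi h).2

/-- `z` strictly separates `x` and `y`. -/
def SepBy (z x y : X) : Prop :=
  ∃ O P : Set X, IsOpen O ∧ IsOpen P ∧ Disjoint O P ∧ O ∪ P = {z}ᶜ ∧ x ∈ O ∧ y ∈ P

lemma SepBy.symm {z x y : X} (h : SepBy z x y) : SepBy z y x := by
  obtain ⟨O, P, h1, h2, h3, h4, h5, h6⟩ := h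
  exact ⟨P, O, h2, h1, h3.symm, by rw [Set.union_comm, h4], h6, h5⟩

lemma image_open (i : Fin (m + 3)) {O : Set X} (hO : IsOpen O) (hb : S.b ∉ O) :
    IsOpen (S.f i '' O) := by
  have : S.f i '' O = (S.f i '' Oᶜ ∪ ⋃ j ∈ {j | j ≠ i}, Set.range (S.f j))ᶜ := by
    ext x
    simp only [Set.mem_compl_iff, Set.mem_union, Set.mem_iUnion, not_or, not_exists]
    constructor
    · rintro ⟨y, hy, rfl⟩
      refine ⟨?_, ?_⟩
      · rintro ⟨z, hz, h⟩
        rw [S.inj i h] at hz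
        exact hz hy
      · rintro j hj ⟨z, hz⟩
        exact hb ((S.inter_c hj hz).2 ▸ hy)
    · rintro ⟨h1, h2⟩
      obtain ⟨j, y, rfl⟩ := S.cover x
      by_cases hj : j = i
      · subst hj
        by_cases hy : y ∈ O
        · exact ⟨y, hy, rfl⟩
        · exact (h1 ⟨y, hy, rfl⟩).elim
      · exact (h2 j hj ⟨y, rfl⟩).elim
  rw [this, isOpen_compl_iff]
  apply IsClosed.union
  · exact (hO.isClosed_compl.isCompact.image (S.cont i)).isClosed
  · exact (Set.toFinite _).isClosed_biUnion (fun j _ => (isCompact_range (S.cont j)).isClosed)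

lemma sep_lift_aux (i : Fin (m + 3)) {z x : X} (h : SepBy z x S.b) :
    SepBy (S.f i z) (S.f i x) S.c ∧ (∀ j y, j ≠ i → SepBy (S.f i z) (S.f i x) (S.f j y)) := by
  obtain ⟨O, P, hO, hP, hd, hu, hx, hb⟩ := h
  have hbO : S.b ∉ O := fun h => Set.disjoint_left.mp hd h hb
  have h1 := S.image_open i hO hbO
  have h2 : IsOpen (S.f i '' Pᶜ)ᶜ := by
    rw [isOpen_compl_iff]
    exact (hP.isClosed_compl.isCompact.image (S.cont i)).isClosed
  have hzO : z ∉ O := fun h => by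
    have : z ∈ ({z}ᶜ : Set X) := hu ▸ Or.inl h
    exact this rfl
  have hzP : z ∉ P := fun h => by
    have : z ∈ ({z}ᶜ : Set X) := hu ▸ Or.inr h
    exact this rfl
  have h3 : Disjoint (S.f i '' O) (S.f i '' Pᶜ)ᶜ := by
    rw [Set.disjoint_compl_right_iff_subset]
    exact Set.image_mono (fun y hy h => Set.disjoint_left.mp hd hy h)
  have h4 : S.f i '' O ∪ (S.f i '' Pᶜ)ᶜ = {S.f i z}ᶜ := by
    ext y
    simp only [Set.mem_union, Set.mem_compl_iff, Set.mem_singleton_iff]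
    constructor
    · rintro (⟨w, hw, rfl⟩ | h) h'
      · rw [S.inj i h'] at hw; exact hzO hw
      · exact h ⟨z, hzP, h'.symm⟩
    · intro h
      by_contra hcon
      push Not at hcon
      obtain ⟨h5, ⟨w, hw, rfl⟩⟩ := hcon
      have : w ∈ O ∪ P := by
        rw [hu]; intro h6; exact h (congrArg _ h6)
      rcases this with h6 | h6
      · exact h5 ⟨w, h6, rfl⟩
      · exact hw h6
  have h5 : ∀ j y, j ≠ i → S.f j y ∈ (S.f i '' Pᶜ)ᶜ := by
    rintro j y hj ⟨w, hw, hwy⟩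
    exact hw ((S.inter_c hj.symm hwy).1 ▸ hb)
  refine ⟨⟨_, _, h1, h2, h3, h4, ⟨x, hx, rfl⟩, ?_⟩, fun j y hj =>
    ⟨_, _, h1, h2, h3, h4, ⟨x, hx, rfl⟩, h5 j y hj⟩⟩
  rintro ⟨w, hw, h⟩
  rw [← S.fb i] at h
  exact hw (S.inj i h ▸ hb)

lemma sep_lift_aux2 (i : Fin (m + 3)) {z x y : X}
    (h : ∃ O P : Set X, IsOpen O ∧ IsOpen P ∧ Disjoint O P ∧ O ∪ P = {z}ᶜ ∧ x ∈ O ∧ y ∈ P ∧ S.b ∈ P) :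
    SepBy (S.f i z) (S.f i x) (S.f i y) := by
  obtain ⟨O, P, hO, hP, hd, hu, hx, hy, hb⟩ := h
  have hbO : S.b ∉ O := fun h => Set.disjoint_left.mp hd h hb
  have h1 := S.image_open i hO hbO
  have h2 : IsOpen (S.f i '' Pᶜ)ᶜ := by
    rw [isOpen_compl_iff]
    exact (hP.isClosed_compl.isCompact.image (S.cont i)).isClosed
  have hzO : z ∉ O := fun h => by
    have : z ∈ ({z}ᶜ : Set X) := hu ▸ Or.inl h
    exact this rfl
  have hzP : z ∉ P := fun h => by
    have : z ∈ ({z}ᶜ : Set X) := hu ▸ Or.inr h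
    exact this rfl
  have h3 : Disjoint (S.f i '' O) (S.f i '' Pᶜ)ᶜ := by
    rw [Set.disjoint_compl_right_iff_subset]
    exact Set.image_mono (fun y hy h => Set.disjoint_left.mp hd hy h)
  have h4 : S.f i '' O ∪ (S.f i '' Pᶜ)ᶜ = {S.f i z}ᶜ := by
    ext y
    simp only [Set.mem_union, Set.mem_compl_iff, Set.mem_singleton_iff]
    constructor
    · rintro (⟨w, hw, rfl⟩ | h) h'
      · rw [S.inj i h'] at hw; exact hzO hw
      · exact h ⟨z, hzP, h'.symm⟩
    · intro h
      by_contra hcon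
      push Not at hcon
      obtain ⟨h5, ⟨w, hw, rfl⟩⟩ := hcon
      have : w ∈ O ∪ P := by
        rw [hu]; intro h6; exact h (congrArg _ h6)
      rcases this with h6 | h6
      · exact h5 ⟨w, h6, rfl⟩
      · exact hw h6
  refine ⟨_, _, h1, h2, h3, h4, ⟨x, hx, rfl⟩, ?_⟩
  rintro ⟨w, hw, h⟩
  exact hw (S.inj i h ▸ hy)

/-- Some branch point separates `x` and `y`. -/
def Sep (x y : X) : Prop := ∃ w, SepBy (S.fw w S.c) x y

lemma Sep.symm' {x y : X} (h : S.Sep x y) : S.Sep y x := by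
  obtain ⟨w, h⟩ := h
  exact ⟨w, h.symm⟩

lemma sep_lift (i : Fin (m + 3)) {x y : X} (h : S.Sep x y) : S.Sep (S.f i x) (S.f i y) := by
  obtain ⟨w, O, P, hO, hP, hd, hu, hx, hy⟩ := h
  have hb : S.b ∈ O ∪ P := by
    rw [hu]; exact fun h => S.fw_c_ne_b w h.symm
  refine ⟨i :: w, ?_⟩
  rcases hb with hb | hb
  · exact (S.sep_lift_aux2 i ⟨P, O, hP, hO, hd.symm, by rw [Set.union_comm, hu], hy, hx, hb⟩).symm
  · exact S.sep_lift_aux2 i ⟨O, P, hO, hP, hd, hu, hx, hy, hb⟩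

/-- The open branches at the centre. -/
def Z (i : Fin (m + 3)) : Set X := S.f i '' {S.b}ᶜ

lemma Z_open (i : Fin (m + 3)) : IsOpen (S.Z i) :=
  S.image_open i isOpen_compl_singleton (by simp)

lemma Z_disj {i j : Fin (m + 3)} (hij : i ≠ j) : Disjoint (S.Z i) (S.Z j) := by
  rw [Set.disjoint_left]
  rintro _ ⟨x, hx, rfl⟩ ⟨y, hy, h⟩
  exact hy (S.inter_c hij.symm h).1

lemma Z_cover {x : X} (hx : x ≠ S.c) : ∃ i, x ∈ S.Z i := by
  obtain ⟨i, y, rfl⟩ := S.cover x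
  refine ⟨i, y, ?_, rfl⟩
  rintro rfl
  exact hx (S.fb i)

lemma c_notin_Z (i : Fin (m + 3)) : S.c ∉ S.Z i := by
  rintro ⟨x, hx, h⟩
  rw [← S.fb i] at h
  exact hx (S.inj i h)

lemma Z_compl (i : Fin (m + 3)) : S.Z i ∪ (⋃ j ∈ {j | j ≠ i}, S.Z j) = {S.c}ᶜ := by
  ext x
  constructor
  · rintro (h | h) h'
    · rw [h'] at h; exact S.c_notin_Z i h
    · simp only [Set.mem_iUnion] at h
      obtain ⟨j, _, h⟩ := h
      rw [h'] at h; exact S.c_notin_Z j h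
  · intro h
    obtain ⟨j, hj⟩ := S.Z_cover h
    by_cases hij : j = i
    · left; exact hij ▸ hj
    · right; simp only [Set.mem_iUnion]; exact ⟨j, hij, hj⟩

lemma Z_rest_open (i : Fin (m + 3)) : IsOpen (⋃ j ∈ {j | j ≠ i}, S.Z j) :=
  isOpen_biUnion fun j _ => S.Z_open j

lemma Z_rest_disj (i : Fin (m + 3)) : Disjoint (S.Z i) (⋃ j ∈ {j | j ≠ i}, S.Z j) := by
  rw [Set.disjoint_left]
  intro x hx h
  simp only [Set.mem_iUnion] at h
  obtain ⟨j, hj, h⟩ := h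
  exact Set.disjoint_left.mp (S.Z_disj (Ne.symm hj)) hx h

lemma sep_c {i j : Fin (m + 3)} (hij : i ≠ j) {x y : X} (hx : x ∈ S.Z i) (hy : y ∈ S.Z j) :
    SepBy S.c x y :=
  ⟨_, _, S.Z_open i, S.Z_rest_open i, S.Z_rest_disj i, S.Z_compl i, hx, by
    simp only [Set.mem_iUnion]; exact ⟨j, hij.symm, hy⟩⟩

lemma a_mem_Z : S.a ∈ S.Z 0 := ⟨S.a, S.ab, S.f0a⟩
lemma b_mem_Z : S.b ∈ S.Z 1 := ⟨S.a, S.ab, S.f1a⟩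

lemma sep_base (i j : Fin (m + 3)) (hij : j ≠ i) (y : X) : S.Sep (S.f i S.a) (S.f j y) :=
  ⟨[i], (S.sep_lift_aux i (S.sep_c (by simp) S.a_mem_Z S.b_mem_Z)).2 j y hij⟩

lemma sep_a {y : X} (hy : y ≠ S.a) : S.Sep S.a y := by
  have key : ∀ k, ∀ y, S.Sep S.a y ∨ ∃ y', y = S.fw (List.replicate k 0) y' := by
    intro k
    induction k with
    | zero => exact fun y => Or.inr ⟨y, rfl⟩
    | succ k ih =>
      intro y
      obtain ⟨j, z, rfl⟩ := S.cover y
      by_cases hj : j = 0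
      · subst hj
        rcases ih z with h | ⟨y', rfl⟩
        · left
          have := S.sep_lift 0 h
          rwa [S.f0a] at this
        · right; exact ⟨y', rfl⟩
      · left
        have := S.sep_base 0 j hj z
        rwa [S.f0a] at this
  have ha : ∀ k, S.fw (List.replicate k 0) S.a = S.a := by
    intro k
    induction k with
    | zero => rfl
    | succ k ih => simp [List.replicate_succ, fw, ih, S.f0a]
  obtain ⟨k, hk⟩ := S.small (dist_pos.mpr hy)
  rcases key k y with h | ⟨y', rfl⟩
  · exact h
  · have := hk (List.replicate k 0) (by simp) y' S.a
    rw [ha k] at this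
    exact (lt_irrefl _ this).elim

lemma sep_b {y : X} (hy : y ≠ S.b) : S.Sep S.b y := by
  obtain ⟨j, z, rfl⟩ := S.cover y
  by_cases hj : j = 1
  · subst hj
    have hz : z ≠ S.a := by
      rintro rfl; exact hy S.f1a
    have := S.sep_lift 1 (S.sep_a hz)
    rwa [S.f1a] at this
  · have := S.sep_base 1 j hj z
    rwa [S.f1a] at this

lemma sep {x y : X} (hxy : x ≠ y) : S.Sep x y := by
  have key : ∀ k, ∀ x y, x ≠ y → S.Sep x y ∨ ∃ w : List (Fin (m + 3)), w.length = k ∧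
      ∃ x' y', x = S.fw w x' ∧ y = S.fw w y' := by
    intro k
    induction k with
    | zero => exact fun x y _ => Or.inr ⟨[], rfl, x, y, rfl, rfl⟩
    | succ k ih =>
      intro x y hxy
      obtain ⟨i, x', rfl⟩ := S.cover x
      obtain ⟨j, y', rfl⟩ := S.cover y
      by_cases hij : i = j
      · subst hij
        rcases ih x' y' (fun h => hxy (congrArg _ h)) with h | ⟨w, hw, x'', y'', rfl, rfl⟩
        · exact Or.inl (S.sep_lift i h)
        · exact Or.inr ⟨i :: w, by simp [hw], x'', y'', rfl, rfl⟩
      · left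
        by_cases hx : x' = S.b
        · subst hx
          rw [S.fb i, ← S.fb j] at hxy ⊢
          exact S.sep_lift j (S.sep_b (fun h => hxy (congrArg _ h.symm)))
        · by_cases hy : y' = S.b
          · subst hy
            rw [S.fb j, ← S.fb i] at hxy ⊢
            exact Sep.symm' _ (S.sep_lift i (S.sep_b (fun h => hxy (congrArg _ h))))
          · exact ⟨[], S.sep_c hij ⟨x', hx, rfl⟩ ⟨y', hy, rfl⟩⟩
  obtain ⟨k, hk⟩ := S.small (dist_pos.mpr hxy)
  rcases key k x y hxy with h | ⟨w, hw, x', y', rfl, rfl⟩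
  · exact h
  · exact (lt_irrefl _ (hk w hw.ge x' y')).elim

end SelfSim

namespace SelfSim

variable {m : ℕ} {X : Type} [MetricSpace X] [CompactSpace X] (S : SelfSim m X)

/-- All first-level cells but one. -/
def R (i : Fin (m + 3)) : Set X := ⋃ j ∈ {j | j ≠ i}, Set.range (S.f j)

lemma mem_R {i : Fin (m + 3)} {x : X} : x ∈ S.R i ↔ ∃ j, j ≠ i ∧ ∃ y, S.f j y = x := by
  simp [R]

lemma exists_ne (i : Fin (m + 3)) : ∃ j : Fin (m + 3), j ≠ i := by
  by_cases h : i = 0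
  · exact ⟨1, by rw [h]; simp⟩
  · exact ⟨0, fun h' => h h'.symm⟩

lemma c_mem_R (i : Fin (m + 3)) : S.c ∈ S.R i := by
  obtain ⟨j, hj⟩ := exists_ne i
  exact S.mem_R.mpr ⟨j, hj, S.b, S.fb j⟩

lemma R_precon (i : Fin (m + 3)) : IsPreconnected (S.R i) := by
  have := S.precon
  unfold R
  rw [← Set.sUnion_image]
  apply isPreconnected_sUnion S.c
  · rintro _ ⟨j, hj, rfl⟩; exact ⟨S.b, S.fb j⟩
  · rintro _ ⟨j, hj, rfl⟩; exact isPreconnected_range (S.cont j)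

lemma cover_R (i : Fin (m + 3)) (x : X) : x ∈ S.R i ∨ ∃ y, x = S.f i y := by
  obtain ⟨j, y, rfl⟩ := S.cover x
  by_cases h : j = i
  · subst h; exact Or.inr ⟨y, rfl⟩
  · exact Or.inl (S.mem_R.mpr ⟨j, h, y, rfl⟩)

lemma fw_zero_a (k : ℕ) : S.fw (List.replicate k 0) S.a = S.a := by
  induction k with
  | zero => rfl
  | succ k ih => simp [List.replicate_succ, fw, ih, S.f0a]

lemma compl_a_precon : IsPreconnected ({S.a}ᶜ : Set X) := by
  have heq : ({S.a}ᶜ : Set X) = ⋃ k : ℕ, S.fw (List.replicate k 0) '' S.R 0 := by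
    ext y
    rw [Set.mem_iUnion]
    constructor
    · intro hy
      have key : ∀ k, ∀ y, (∃ k, y ∈ S.fw (List.replicate k 0) '' S.R 0) ∨
          ∃ y', y = S.fw (List.replicate k 0) y' := by
        intro k
        induction k with
        | zero => exact fun y => Or.inr ⟨y, rfl⟩
        | succ k ih =>
          intro y
          rcases S.cover_R 0 y with h | ⟨z, rfl⟩
          · exact Or.inl ⟨0, y, h, rfl⟩
          · rcases ih z with ⟨l, r, hr, rfl⟩ | ⟨y', rfl⟩
            · exact Or.inl ⟨l + 1, r, hr, rfl⟩
            · exact Or.inr ⟨y', rfl⟩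
      obtain ⟨k, hk⟩ := S.small (dist_pos.mpr hy)
      rcases key k y with h | ⟨y', rfl⟩
      · exact h
      · have := hk (List.replicate k 0) (by simp) y' S.a
        rw [S.fw_zero_a k] at this
        exact (lt_irrefl _ this).elim
    · rintro ⟨k, r, hr, rfl⟩ h
      rw [Set.mem_singleton_iff] at h
      have := S.fw_inj _ (h.trans (S.fw_zero_a k).symm)
      obtain ⟨j, hj, y, rfl⟩ := S.mem_R.mp hr
      rw [← S.f0a] at this
      exact S.ab (S.inter_c hj this).2
  rw [heq]
  apply IsPreconnected.iUnion_of_chain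
  · intro k
    exact (S.R_precon 0).image _ (S.fw_cont _).continuousOn
  · intro k
    refine ⟨S.fw (List.replicate k 0) S.c, ⟨_, S.c_mem_R 0, rfl⟩, S.b, ?_, ?_⟩
    · exact S.mem_R.mpr ⟨1, by simp, S.a, S.f1a⟩
    · rw [Order.succ_eq_add_one, List.replicate_succ', fw_append]
      simp [fw, S.fb]

lemma compl_b_precon : IsPreconnected ({S.b}ᶜ : Set X) := by
  have heq : ({S.b}ᶜ : Set X) = S.R 1 ∪ S.f 1 '' {S.a}ᶜ := by
    ext x
    constructor
    · intro hx
      rcases S.cover_R 1 x with h | ⟨y, rfl⟩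
      · exact Or.inl h
      · refine Or.inr ⟨y, ?_, rfl⟩
        rintro rfl
        exact hx S.f1a
    · rintro (h | ⟨y, hy, rfl⟩) hb
      · obtain ⟨j, hj, y, rfl⟩ := S.mem_R.mp h
        rw [Set.mem_singleton_iff, ← S.f1a] at hb
        exact S.ab (S.inter_c hj hb).2
      · rw [Set.mem_singleton_iff] at hb
        exact hy (S.inj 1 (hb.trans S.f1a.symm))
  rw [heq]
  apply IsPreconnected.union S.c (S.c_mem_R 1)
  · exact ⟨S.b, S.ab.symm, S.fb 1⟩
  · exact S.R_precon 1
  · exact S.compl_a_precon.image _ (S.cont 1).continuousOn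

lemma Z_precon (i : Fin (m + 3)) : IsPreconnected (S.Z i) :=
  S.compl_b_precon.image _ (S.cont i).continuousOn

lemma Z_sub (i : Fin (m + 3)) : S.Z i ⊆ {S.c}ᶜ := by
  rw [← S.Z_compl i]; exact Set.subset_union_left

lemma precon_sub_Z {i : Fin (m + 3)} {A : Set X} (hA : IsPreconnected A) (hc : A ⊆ {S.c}ᶜ)
    {x : X} (hx : x ∈ A) (hxi : x ∈ S.Z i) : A ⊆ S.Z i :=
  hA.subset_left_of_subset_union (S.Z_open i) (S.Z_rest_open i) (S.Z_rest_disj i)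
    (by rw [S.Z_compl i]; exact hc) ⟨x, hx, hxi⟩

lemma comp_c {i : Fin (m + 3)} {x : X} (hx : x ∈ S.Z i) :
    connectedComponentIn {S.c}ᶜ x = S.Z i := by
  apply Set.Subset.antisymm
  · exact S.precon_sub_Z isPreconnected_connectedComponentIn (connectedComponentIn_subset _ _)
      (mem_connectedComponentIn (S.Z_sub i hx)) hx
  · exact (S.Z_precon i).subset_connectedComponentIn hx (S.Z_sub i)

lemma Z_nonempty (i : Fin (m + 3)) : (S.Z i).Nonempty := ⟨_, S.a, S.ab, rfl⟩

lemma Z_injective : Function.Injective S.Z := by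
  intro i j h
  by_contra hij
  obtain ⟨x, hx⟩ := S.Z_nonempty i
  exact Set.disjoint_left.mp (S.Z_disj hij) hx (h ▸ hx)

lemma order_c : ptOrder X S.c = m + 3 := by
  have : setComponents X {S.c}ᶜ = S.Z '' Set.univ := by
    ext C
    constructor
    · rintro ⟨x, hx, rfl⟩
      obtain ⟨i, hi⟩ := S.Z_cover hx
      exact ⟨i, trivial, (S.comp_c hi).symm⟩
    · rintro ⟨i, -, rfl⟩
      obtain ⟨x, hx⟩ := S.Z_nonempty i
      exact ⟨x, S.Z_sub i hx, (S.comp_c hx).symm⟩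
  unfold ptOrder
  rw [this, Set.ncard_image_of_injective _ S.Z_injective, Set.ncard_univ]
  simp

lemma order_homeo (h : X ≃ₜ X) (p : X) : ptOrder X (h p) = ptOrder X p := by
  have : setComponents X {h p}ᶜ = (fun A => h '' A) '' setComponents X {p}ᶜ := by
    have hi : h '' {p}ᶜ = {h p}ᶜ := by
      rw [Set.image_compl_eq h.bijective, Set.image_singleton]
    ext C
    constructor
    · rintro ⟨x, hx, rfl⟩
      have hx' : h.symm x ∈ ({p}ᶜ : Set X) := by
        intro h'
        apply hx
        rw [Set.mem_singleton_iff] at h' ⊢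
        rw [← h', h.apply_symm_apply]
      refine ⟨_, ⟨h.symm x, hx', rfl⟩, ?_⟩
      have := h.image_connectedComponentIn hx'
      simp only
      rw [this, hi, h.apply_symm_apply]
    · rintro ⟨_, ⟨x, hx, rfl⟩, rfl⟩
      refine ⟨h x, fun h' => hx (h.injective h'), ?_⟩
      simp only
      rw [h.image_connectedComponentIn hx, hi]
  unfold ptOrder
  rw [this, Set.ncard_image_of_injective _ (Set.image_injective.mpr h.injective)]

/-- The branch points. -/
def Br : Set X := {p | ∃ w, p = S.fw w S.c}

lemma a_eq_fw (w : List (Fin (m + 3))) (x : X) (h : S.a = S.fw w x) : x = S.a := by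
  induction w with
  | nil => exact h.symm
  | cons i w ih =>
    rw [← S.f0a] at h
    by_cases hi : i = 0
    · subst hi; exact ih (S.inj 0 h)
    · exact (S.ab (S.inter_c (Ne.symm hi) h).1).elim

lemma b_eq_fw (w : List (Fin (m + 3))) (x : X) (h : S.b = S.fw w x) :
    (x = S.b ∧ w = []) ∨ x = S.a := by
  cases w with
  | nil => exact Or.inl ⟨h.symm, rfl⟩
  | cons i w =>
    rw [← S.f1a] at h
    by_cases hi : i = 1
    · subst hi; exact Or.inr (S.a_eq_fw w x (S.inj 1 h))
    · exact (S.ab (S.inter_c (Ne.symm hi) h).1).elim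

lemma b_not_Br : S.b ∉ S.Br := by
  rintro ⟨w, h⟩
  exact S.fw_c_ne_b w h.symm

lemma Br_lift {p : X} (i : Fin (m + 3)) (h : p ∈ S.Br) : S.f i p ∈ S.Br := by
  obtain ⟨w, rfl⟩ := h
  exact ⟨i :: w, rfl⟩

/-- The part of the complement of a cell attached at one of its ends `e`. -/
structure Side (w : List (Fin (m + 3))) (e : X) (A : Set X) : Prop where
  pre : IsPreconnected A
  meet : ∀ x ∈ A, x ∈ S.cell w → x = S.fw w e
  br : A.Nonempty → S.fw w e ∈ S.Br ∧ S.fw w e ∈ A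

lemma side_empty (w : List (Fin (m + 3))) (e : X) : S.Side w e ∅ :=
  ⟨isPreconnected_empty, fun _ h => h.elim, fun h => (Set.not_nonempty_empty h).elim⟩

lemma side_lift {w : List (Fin (m + 3))} {e : X} {A : Set X} (i : Fin (m + 3))
    (h : S.Side w e A) : S.Side (i :: w) e (S.f i '' A) := by
  refine ⟨h.pre.image _ (S.cont i).continuousOn, ?_, ?_⟩
  · rintro _ ⟨x, hx, rfl⟩ ⟨y, hy⟩
    have := S.inj i hy
    exact congrArg (S.f i) (h.meet x hx ⟨y, this⟩)
  · rintro ⟨_, ⟨x, hx, rfl⟩⟩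
    have := h.br ⟨x, hx⟩
    exact ⟨S.Br_lift i this.1, ⟨_, this.2, rfl⟩⟩

lemma R_meet {i : Fin (m + 3)} {w : List (Fin (m + 3))} {x : X} (hx : x ∈ S.R i)
    (hc : x ∈ S.cell (i :: w)) : x = S.c ∧ S.b ∈ S.cell w := by
  obtain ⟨j, hj, y, rfl⟩ := S.mem_R.mp hx
  obtain ⟨z, hz⟩ := hc
  have := S.inter_c hj.symm hz
  exact ⟨by rw [this.2, S.fb], ⟨z, this.1⟩⟩

lemma side_add {w : List (Fin (m + 3))} {e : X} {A : Set X} (i : Fin (m + 3))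
    (h : S.Side w e A) (hb : S.b ∈ A) : S.Side (i :: w) e (S.f i '' A ∪ S.R i) := by
  have h' := S.side_lift i h
  refine ⟨?_, ?_, ?_⟩
  · exact IsPreconnected.union S.c ⟨S.b, hb, S.fb i⟩ (S.c_mem_R i) h'.pre (S.R_precon i)
  · rintro x (hx | hx) hc
    · exact h'.meet x hx hc
    · have := S.R_meet hx hc
      have h2 := h.meet S.b hb this.2
      rw [this.1, ← S.fb i, h2]
      rfl
  · intro _
    have := h'.br ⟨_, ⟨S.b, hb, rfl⟩⟩
    exact ⟨this.1, Or.inl this.2⟩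

lemma side_new {w : List (Fin (m + 3))} {e : X} (i : Fin (m + 3))
    (hb : S.b = S.fw w e) : S.Side (i :: w) e (S.R i) := by
  have : S.fw (i :: w) e = S.c := by
    rw [← S.fb i, hb]; rfl
  refine ⟨S.R_precon i, ?_, ?_⟩
  · intro x hx hc
    rw [this]; exact (S.R_meet hx hc).1
  · intro _
    rw [this]
    exact ⟨⟨[], rfl⟩, S.c_mem_R i⟩

lemma sides (w : List (Fin (m + 3))) : ∃ A B : Set X, S.Side w S.a A ∧ S.Side w S.b B ∧
    ∀ x, x ∈ A ∨ x ∈ S.cell w ∨ x ∈ B := by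
  induction w with
  | nil => exact ⟨∅, ∅, S.side_empty _ _, S.side_empty _ _, fun x => Or.inr (Or.inl ⟨x, rfl⟩)⟩
  | cons i w ih =>
    obtain ⟨A, B, hA, hB, hcov⟩ := ih
    have hcov' : ∀ x, x ∈ S.f i '' A ∨ x ∈ S.cell (i :: w) ∨ x ∈ S.f i '' B ∨ x ∈ S.R i := by
      intro x
      rcases S.cover_R i x with h | ⟨y, rfl⟩
      · exact Or.inr (Or.inr (Or.inr h))
      · rcases hcov y with h | ⟨z, rfl⟩ | h
        · exact Or.inl ⟨y, h, rfl⟩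
        · exact Or.inr (Or.inl ⟨z, rfl⟩)
        · exact Or.inr (Or.inr (Or.inl ⟨y, h, rfl⟩))
    rcases hcov S.b with h | ⟨z, hz⟩ | h
    · refine ⟨S.f i '' A ∪ S.R i, S.f i '' B, S.side_add i hA h, S.side_lift i hB, ?_⟩
      intro x
      have := hcov' x
      simp only [Set.mem_union]
      tauto
    · rcases S.b_eq_fw w z hz.symm with ⟨rfl, rfl⟩ | rfl
      · refine ⟨S.f i '' A, S.R i, S.side_lift i hA, S.side_new i hz.symm, ?_⟩
        intro x
        rcases hcov' x with h | h | ⟨y, hy, rfl⟩ | h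
        · exact Or.inl h
        · exact Or.inr (Or.inl h)
        · exact Or.inr (Or.inl ⟨y, rfl⟩)
        · exact Or.inr (Or.inr h)
      · have hAe : A = ∅ := by
          by_contra hne
          have := (hA.br (Set.nonempty_iff_ne_empty.mpr hne)).1
          rw [hz] at this
          exact S.b_not_Br this
        refine ⟨S.R i, S.f i '' B, S.side_new i hz.symm, S.side_lift i hB, ?_⟩
        intro x
        have := hcov' x
        rw [hAe] at this
        simp only [Set.image_empty, Set.mem_empty_iff_false] at this
        tauto
    · refine ⟨S.f i '' A, S.f i '' B ∪ S.R i, S.side_lift i hA, S.side_add i hB h, ?_⟩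
      intro x
      have := hcov' x
      simp only [Set.mem_union]
      tauto

lemma side_avoid {w : List (Fin (m + 3))} {e : X} {A : Set X} (h : S.Side w e A) {p : X}
    (hp : p ∈ S.cell w) (hbr : p ∉ S.Br) : A ⊆ {p}ᶜ := by
  intro x hx hxp
  rw [Set.mem_singleton_iff] at hxp
  subst hxp
  have h1 := h.meet x hx hp
  have h2 := (h.br ⟨x, hx⟩).1
  rw [← h1] at h2
  exact hbr h2

lemma order_other {p : X} (hp : p ∉ S.Br) : ptOrder X p = 1 ∨ ptOrder X p = 2 := by
  have three : ∀ x y z : X, x ≠ p → y ≠ p → z ≠ p →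
      connectedComponentIn {p}ᶜ x = connectedComponentIn {p}ᶜ y ∨
      connectedComponentIn {p}ᶜ x = connectedComponentIn {p}ᶜ z ∨
      connectedComponentIn {p}ᶜ y = connectedComponentIn {p}ᶜ z := by
    intro x y z hx hy hz
    obtain ⟨k, hk⟩ := S.small (ε := min (dist x p) (min (dist y p) (dist z p)))
      (lt_min (dist_pos.mpr hx) (lt_min (dist_pos.mpr hy) (dist_pos.mpr hz)))
    obtain ⟨w, hw, q, rfl⟩ := S.addr k p
    have hpc : S.fw w q ∈ S.cell w := ⟨q, rfl⟩
    have hx' : x ∉ S.cell w := by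
      rintro ⟨x', rfl⟩
      exact absurd (hk w hw.ge x' q) (not_lt.mpr (min_le_left _ _))
    have hy' : y ∉ S.cell w := by
      rintro ⟨x', rfl⟩
      exact absurd (hk w hw.ge x' q) (not_lt.mpr ((min_le_right _ _).trans (min_le_left _ _)))
    have hz' : z ∉ S.cell w := by
      rintro ⟨x', rfl⟩
      exact absurd (hk w hw.ge x' q) (not_lt.mpr ((min_le_right _ _).trans (min_le_right _ _)))
    obtain ⟨A, B, hA, hB, hcov⟩ := S.sides w
    have same : ∀ (e : X) (C : Set X), S.Side w e C → ∀ u v, u ∈ C → v ∈ C →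
        connectedComponentIn {S.fw w q}ᶜ u = connectedComponentIn {S.fw w q}ᶜ v := by
      intro e C hC u v hu hv
      apply connectedComponentIn_eq
      exact hC.pre.subset_connectedComponentIn hu (S.side_avoid hC hpc hp) hv
    have sA := same _ _ hA
    have sB := same _ _ hB
    have tx := hcov x
    have ty := hcov y
    have tz := hcov z
    simp only [hx', hy', hz', false_or] at tx ty tz
    rcases tx with tx | tx <;> rcases ty with ty | ty
    · exact Or.inl (sA _ _ tx ty)
    · rcases tz with tz | tz
      · exact Or.inr (Or.inl (sA _ _ tx tz))
      · exact Or.inr (Or.inr (sB _ _ ty tz))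
    · rcases tz with tz | tz
      · exact Or.inr (Or.inr (sA _ _ ty tz))
      · exact Or.inr (Or.inl (sB _ _ tx tz))
    · exact Or.inl (sB _ _ tx ty)
  have hex : ∃ x, x ≠ p := by
    by_cases h : S.a = p
    · exact ⟨S.b, fun h' => S.ab (h.trans h'.symm)⟩
    · exact ⟨S.a, h⟩
  obtain ⟨x, hx⟩ := hex
  unfold ptOrder
  by_cases hall : ∀ y, y ≠ p → connectedComponentIn {p}ᶜ x = connectedComponentIn {p}ᶜ y
  · left
    rw [Set.ncard_eq_one]
    refine ⟨connectedComponentIn {p}ᶜ x, ?_⟩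
    ext C
    constructor
    · rintro ⟨y, hy, rfl⟩; exact (hall y hy).symm
    · rintro rfl; exact ⟨x, hx, rfl⟩
  · push Not at hall
    obtain ⟨y, hy, hne⟩ := hall
    right
    rw [Set.ncard_eq_two]
    refine ⟨_, _, hne, ?_⟩
    ext C
    constructor
    · rintro ⟨z, hz, rfl⟩
      rcases three x y z hx hy hz with h | h | h
      · exact (hne h).elim
      · exact Or.inl h.symm
      · exact Or.inr h.symm
    · rintro (rfl | rfl)
      · exact ⟨x, hx, rfl⟩
      · exact ⟨y, hy, rfl⟩

lemma SepBy.mem_of_precon {z x y : X} (h : SepBy z x y) {A : Set X} (hA : IsPreconnected A)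
    (hx : x ∈ A) (hy : y ∈ A) : z ∈ A := by
  by_contra hz
  obtain ⟨O, P, hO, hP, hd, hu, hxO, hyP⟩ := h
  have := hA.subset_left_of_subset_union hO hP hd (by
    rw [hu]; intro t ht htz; rw [Set.mem_singleton_iff] at htz; exact hz (htz ▸ ht)) ⟨x, hx, hxO⟩
  exact Set.disjoint_left.mp hd (this hy) hyP

lemma arc_br (A : Set X) (e : A ≃ₜ unitInterval) : ∃ p ∈ A, p ∈ S.Br := by
  have hA : IsPreconnected A := by
    have h0 : A = Set.range (fun t => (e.symm t : X)) := by
      ext x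
      exact ⟨fun hx => ⟨e ⟨x, hx⟩, by simp⟩, by rintro ⟨t, rfl⟩; exact (e.symm t).2⟩
    rw [h0]
    exact isPreconnected_range (continuous_subtype_val.comp e.symm.continuous)
  have hne : (e.symm 0 : X) ≠ e.symm 1 := by
    intro h
    have := e.symm.injective (Subtype.ext h)
    exact zero_ne_one this
  obtain ⟨w, hw⟩ := S.sep hne
  exact ⟨_, hw.mem_of_precon hA (e.symm 0).2 (e.symm 1).2, w, rfl⟩

lemma circle_punctured (p : Circle) : IsPreconnected ({p}ᶜ : Set Circle) := by
  have : ({p}ᶜ : Set Circle) = (fun t : ℝ => p * Circle.exp t) '' Set.Ioo 0 (2 * Real.pi) := by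
    ext q
    constructor
    · intro hq
      obtain ⟨s, hs⟩ : ∃ s : ℝ, Circle.exp s = p⁻¹ * q := ⟨_, Circle.exp_arg _⟩
      have hpi : (0 : ℝ) < 2 * Real.pi := Real.two_pi_pos
      have hm := toIcoMod_mem_Ico hpi 0 s
      have he : Circle.exp (toIcoMod hpi 0 s) = Circle.exp s := by
        rw [toIcoMod]
        simp only [zsmul_eq_mul]
        exact Circle.periodic_exp.sub_int_mul_eq _
      rw [zero_add] at hm
      refine ⟨toIcoMod hpi 0 s, ⟨lt_of_le_of_ne hm.1 ?_, hm.2⟩, ?_⟩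
      · intro h0
        rw [← h0, Circle.exp_zero, hs] at he
        apply hq
        rw [Set.mem_singleton_iff]
        rw [eq_comm, inv_mul_eq_one] at he
        exact he.symm
      · simp only
        rw [he, hs, mul_inv_cancel_left]
    · rintro ⟨t, ht, rfl⟩ h
      rw [Set.mem_singleton_iff] at h
      have h1 : Circle.exp t = 1 := by simpa using h
      rw [Circle.exp_eq_one] at h1
      obtain ⟨k, hk⟩ := h1
      have hpi : (0 : ℝ) < 2 * Real.pi := Real.two_pi_pos
      rw [hk] at ht
      obtain ⟨h2, h3⟩ := ht
      have h4 : (0 : ℝ) < k := by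
        by_contra hc
        nlinarith
      have h5 : (k : ℝ) < 1 := by nlinarith
      have h6 : 0 < k := by exact_mod_cast h4
      have h7 : k < 1 := by exact_mod_cast h5
      omega
  rw [this]
  exact isPreconnected_Ioo.image _ (by fun_prop)

lemma no_circle (S : SelfSim m X) (A : Set X) : IsEmpty (A ≃ₜ Circle) := by
  constructor
  intro e
  have hne : (e.symm 1 : X) ≠ e.symm (-1) := by
    intro h
    have := congrArg (fun z : Circle => (z : ℂ)) (e.symm.injective (Subtype.ext h))
    simp only [Circle.coe_one] at this
    norm_num [Complex.ext_iff] at this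
  obtain ⟨w, hw⟩ := S.sep hne
  set z := S.fw w S.c
  have hz : ∀ x y, SepBy z x y → x ≠ z ∧ y ≠ z := by
    rintro x y ⟨O, P, -, -, -, hu, hx, hy⟩
    have h1 : x ∈ ({z}ᶜ : Set X) := hu ▸ Or.inl hx
    have h2 : y ∈ ({z}ᶜ : Set X) := hu ▸ Or.inr hy
    exact ⟨h1, h2⟩
  obtain ⟨h1, h2⟩ := hz _ _ hw
  by_cases hzA : z ∈ A
  · have hp := (circle_punctured (e ⟨z, hzA⟩)).image (fun t => (e.symm t : X))
      (continuous_subtype_val.comp e.symm.continuous).continuousOn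
    obtain ⟨t, ht, htz⟩ := hw.mem_of_precon hp
      ⟨1, fun h => h1 (by rw [Set.mem_singleton_iff] at h; rw [h, e.symm_apply_apply]), rfl⟩
      ⟨-1, fun h => h2 (by rw [Set.mem_singleton_iff] at h; rw [h, e.symm_apply_apply]), rfl⟩
    apply ht
    rw [Set.mem_singleton_iff]
    rw [← e.apply_symm_apply t]
    congr 1
    exact Subtype.ext htz
  · have hA : IsPreconnected A := by
      have : PreconnectedSpace Circle := by
        have h3 : IsPreconnected (Set.univ : Set Circle) := by
          have : (Set.univ : Set Circle) = Set.range Circle.exp := by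
            ext q; simp only [Set.mem_univ, true_iff]; exact ⟨_, Circle.exp_arg q⟩
          rw [this]
          exact isPreconnected_range Circle.exp.continuous
        exact ⟨h3⟩
      have h0 : A = Set.range (fun t => (e.symm t : X)) := by
        ext x
        exact ⟨fun hx => ⟨e ⟨x, hx⟩, by simp⟩, by rintro ⟨t, rfl⟩; exact (e.symm t).2⟩
      rw [h0]
      exact isPreconnected_range (continuous_subtype_val.comp e.symm.continuous)
    exact hzA (hw.mem_of_precon hA (e.symm 1).2 (e.symm (-1)).2)

lemma dendrite (S : SelfSim m X) : IsDendrite X := by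
  refine ⟨⟨S.a⟩, inferInstance, ?_, S.locConn, inferInstance, S.no_circle⟩
  have := S.precon
  exact { toNonempty := ⟨S.a⟩ }

end SelfSim

namespace SelfSim

variable {m : ℕ} {X : Type} [MetricSpace X] [CompactSpace X] (S : SelfSim m X)

lemma h_mul (g h : X ≃ₜ X) (x : X) : (g * h) x = g (h x) := rfl
lemma h_one (x : X) : (1 : X ≃ₜ X) x = x := rfl
lemma h_inv_apply (g : X ≃ₜ X) (x : X) : g⁻¹ (g x) = x := g.symm_apply_apply x
lemma h_apply_inv (g : X ≃ₜ X) (x : X) : g (g⁻¹ x) = x := g.apply_symm_apply x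
lemma h_inv_eq {g : X ≃ₜ X} {x y : X} (h : g x = y) : g⁻¹ y = x := by rw [← h, h_inv_apply]

lemma n01 : (0 : Fin (m + 3)) ≠ 1 := by simp
lemma n02 : (0 : Fin (m + 3)) ≠ 2 := by
  intro h; have := congrArg Fin.val h; simp at this; rw [Nat.mod_eq_of_lt (by omega)] at this; omega
lemma n12 : (1 : Fin (m + 3)) ≠ 2 := by
  intro h; have := congrArg Fin.val h; simp at this; rw [Nat.mod_eq_of_lt (by omega)] at this; omega

/-- Glue maps defined on the cells. -/
noncomputable def glue (F : Fin (m + 3) → X → X) (x : X) : X :=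
  F (S.cover x).choose (S.cover x).choose_spec.choose

lemma glue_f (F : Fin (m + 3) → X → X) (hF : ∀ i j, F i S.b = F j S.b) (i : Fin (m + 3)) (x : X) :
    S.glue F (S.f i x) = F i x := by
  have key : ∀ j y, S.f i x = S.f j y → F j y = F i x := by
    intro j y h
    by_cases hij : i = j
    · subst hij
      rw [S.inj i h]
    · obtain ⟨h1, h2⟩ := S.inter_c hij h
      rw [h1, h2]
      exact hF _ _
  exact key _ _ (S.cover (S.f i x)).choose_spec.choose_spec

lemma glue_cont (F : Fin (m + 3) → X → X) (hF : ∀ i j, F i S.b = F j S.b)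
    (hc : ∀ i, Continuous (F i)) : Continuous (S.glue F) := by
  have hq : IsQuotientMap (fun p : Fin (m + 3) × X => S.f p.1 p.2) := by
    apply IsQuotientMap.of_surjective_continuous
    · intro x
      obtain ⟨i, y, h⟩ := S.cover x
      exact ⟨(i, y), h.symm⟩
    · exact continuous_prod_of_discrete_left.mpr S.cont
  rw [hq.continuous_iff]
  have : S.glue F ∘ (fun p : Fin (m + 3) × X => S.f p.1 p.2) = fun p => F p.1 p.2 := by
    funext p
    exact S.glue_f F hF _ _
  rw [this]
  exact continuous_prod_of_discrete_left.mpr hc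

lemma hext {g h : X ≃ₜ X} (H : ∀ i x, g (S.f i x) = h (S.f i x)) : g = h := by
  apply Homeomorph.ext
  intro x
  obtain ⟨i, y, rfl⟩ := S.cover x
  exact H i y

/-- The stabilizer of the end point `b`. -/
def B : Subgroup (X ≃ₜ X) where
  carrier := {g | g S.b = S.b}
  one_mem' := rfl
  mul_mem' := by
    intro g h hg hh
    change g (h S.b) = S.b
    rw [show h S.b = S.b from hh]; exact hg
  inv_mem' := by
    intro g hg
    exact h_inv_eq hg

lemma B_b (g : S.B) : (g : X ≃ₜ X) S.b = S.b := g.2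

/-- Homeomorphisms permuting the cells. -/
noncomputable def wr (π : Equiv.Perm (Fin (m + 3))) (g : Fin (m + 3) → S.B) : X ≃ₜ X where
  toFun := S.glue fun i x => S.f (π i) ((g i : X ≃ₜ X) x)
  invFun := S.glue fun i x => S.f (π⁻¹ i) (((g (π⁻¹ i))⁻¹ : S.B).1 x)
  left_inv := by
    intro x
    obtain ⟨i, y, rfl⟩ := S.cover x
    rw [S.glue_f _ (by intro i j; rw [B_b, B_b, S.fb, S.fb]),
      S.glue_f _ (by intro i j; rw [B_b, B_b, S.fb, S.fb])]
    have hp : π⁻¹ (π i) = i := π.symm_apply_apply i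
    rw [hp]
    congr 1
    exact h_inv_apply _ _
  right_inv := by
    intro x
    obtain ⟨i, y, rfl⟩ := S.cover x
    rw [S.glue_f _ (by intro i j; rw [B_b, B_b, S.fb, S.fb]),
      S.glue_f _ (by intro i j; rw [B_b, B_b, S.fb, S.fb])]
    have hp : π (π⁻¹ i) = i := π.apply_symm_apply i
    rw [hp]
    congr 1
    exact h_apply_inv _ _
  continuous_toFun := S.glue_cont _ (by intro i j; rw [B_b, B_b, S.fb, S.fb])
    fun i => (S.cont _).comp (Homeomorph.continuous _)
  continuous_invFun := S.glue_cont _ (by intro i j; rw [B_b, B_b, S.fb, S.fb])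
    fun i => (S.cont _).comp (Homeomorph.continuous _)

lemma wr_f (π : Equiv.Perm (Fin (m + 3))) (g : Fin (m + 3) → S.B) (i : Fin (m + 3)) (x : X) :
    S.wr π g (S.f i x) = S.f (π i) ((g i : X ≃ₜ X) x) :=
  S.glue_f (fun i x => S.f (π i) ((g i : X ≃ₜ X) x)) (by intro i j; rw [B_b, B_b, S.fb, S.fb]) i x

/-- Permutations of the cells. -/
noncomputable def sg : Equiv.Perm (Fin (m + 3)) →* (X ≃ₜ X) where
  toFun π := S.wr π 1
  map_one' := S.hext fun i x => by rw [wr_f]; rfl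
  map_mul' π π' := S.hext fun i x => by rw [wr_f, h_mul, wr_f, wr_f]; rfl

lemma sg_f (π : Equiv.Perm (Fin (m + 3))) (i : Fin (m + 3)) (x : X) :
    S.sg π (S.f i x) = S.f (π i) x := S.wr_f _ _ _ _

/-- Homeomorphisms preserving each cell. -/
noncomputable def ws : (Fin (m + 3) → S.B) →* (X ≃ₜ X) where
  toFun g := S.wr 1 g
  map_one' := S.hext fun i x => by rw [wr_f]; rfl
  map_mul' g g' := S.hext fun i x => by rw [wr_f, h_mul, wr_f, wr_f]; rfl

lemma ws_f (g : Fin (m + 3) → S.B) (i : Fin (m + 3)) (x : X) :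
    S.ws g (S.f i x) = S.f i ((g i : X ≃ₜ X) x) := S.wr_f _ _ _ _

/-- Homeomorphisms supported in one cell. -/
noncomputable def ex (i : Fin (m + 3)) : S.B →* (X ≃ₜ X) :=
  S.ws.comp (MonoidHom.mulSingle (fun _ => S.B) i)

lemma ex_eq (i : Fin (m + 3)) (g : S.B) : S.ex i g = S.ws (Pi.mulSingle i g) := rfl

lemma ex_f (i : Fin (m + 3)) (g : S.B) (x : X) :
    S.ex i g (S.f i x) = S.f i ((g : X ≃ₜ X) x) := by
  rw [ex_eq, ws_f, Pi.mulSingle_eq_same]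

lemma ex_ne {i j : Fin (m + 3)} (h : j ≠ i) (g : S.B) (x : X) :
    S.ex i g (S.f j x) = S.f j x := by
  rw [ex_eq, ws_f, Pi.mulSingle_eq_of_ne h]; rfl

lemma ex_off {i : Fin (m + 3)} (g : S.B) {p : X} (h : ∀ y, p ≠ S.f i y) :
    S.ex i g p = p := by
  obtain ⟨j, y, rfl⟩ := S.cover p
  apply S.ex_ne
  rintro rfl
  exact h y rfl

lemma wr_eq (π : Equiv.Perm (Fin (m + 3))) (g : Fin (m + 3) → S.B) :
    S.wr π g = S.sg π * S.ws g :=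
  S.hext fun i x => by rw [wr_f, h_mul, ws_f, sg_f]

lemma stab_map {g : X ≃ₜ X} (hg : g S.c = S.c) :
    ∃ (π : Fin (m + 3) → Fin (m + 3)) (k : Fin (m + 3) → X → X),
      ∀ i x, g (S.f i x) = S.f (π i) (k i x) := by
  have h : ∀ i, ∃ j, ∀ x, ∃ y, g (S.f i x) = S.f j y := by
    intro i
    have h1 : g (S.f i S.a) ≠ S.c := by
      intro h
      rw [← hg] at h
      have := g.injective h
      rw [← S.fb i] at this
      exact S.ab (S.inj i this)
    obtain ⟨j, hj⟩ := S.Z_cover h1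
    have h2 : g '' S.Z i ⊆ S.Z j := by
      refine S.precon_sub_Z ((S.Z_precon i).image _ g.continuous.continuousOn) ?_
        ⟨_, ⟨S.a, S.ab, rfl⟩, rfl⟩ hj
      rintro _ ⟨x, hx, rfl⟩ h
      rw [Set.mem_singleton_iff, ← hg] at h
      rw [g.injective h] at hx
      exact S.c_notin_Z i hx
    refine ⟨j, fun x => ?_⟩
    by_cases hx : x = S.b
    · exact ⟨S.b, by rw [hx, S.fb, S.fb, hg]⟩
    · obtain ⟨y, _, hy⟩ := h2 ⟨_, ⟨x, hx, rfl⟩, rfl⟩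
      exact ⟨y, hy.symm⟩
  choose π k hk using h
  exact ⟨π, k, hk⟩

lemma k_cont {g : X ≃ₜ X} {π : Fin (m + 3) → Fin (m + 3)} {k : Fin (m + 3) → X → X}
    (h : ∀ i x, g (S.f i x) = S.f (π i) (k i x)) (i : Fin (m + 3)) : Continuous (k i) := by
  rw [((S.cont (π i)).isClosedEmbedding (S.inj (π i))).isInducing.continuous_iff]
  have : S.f (π i) ∘ k i = g ∘ S.f i := by
    funext x; exact (h i x).symm
  rw [this]
  exact g.continuous.comp (S.cont i)

lemma k_inv {g g' : X ≃ₜ X} (hgg : ∀ x, g' (g x) = x)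
    {π : Fin (m + 3) → Fin (m + 3)} {k : Fin (m + 3) → X → X}
    (h : ∀ i x, g (S.f i x) = S.f (π i) (k i x))
    {π' : Fin (m + 3) → Fin (m + 3)} {k' : Fin (m + 3) → X → X}
    (h' : ∀ i x, g' (S.f i x) = S.f (π' i) (k' i x)) (i : Fin (m + 3)) :
    π' (π i) = i ∧ ∀ x, k' (π i) (k i x) = x := by
  have h0 : ∀ x, S.f i x = S.f (π' (π i)) (k' (π i) (k i x)) := by
    intro x
    rw [← h', ← h, hgg]
  have h1 : π' (π i) = i := by
    by_contra hne
    exact S.ab (S.inter_c (Ne.symm hne) (h0 S.a)).1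
  refine ⟨h1, fun x => ?_⟩
  have := h0 x
  rw [h1] at this
  exact (S.inj i this).symm

lemma stab_c {g : X ≃ₜ X} (hg : g S.c = S.c) : ∃ π k, g = S.wr π k := by
  obtain ⟨π, k, h⟩ := S.stab_map hg
  obtain ⟨π', k', h'⟩ := S.stab_map (h_inv_eq hg)
  have h1 := S.k_inv (h_inv_apply g) h h'
  have h2 := S.k_inv (h_apply_inv g) h' h
  let P : Equiv.Perm (Fin (m + 3)) := ⟨π, π', fun i => (h1 i).1, fun i => (h2 i).1⟩
  have hr : ∀ i x, k i (k' (π i) x) = x := by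
    intro i x
    have := (h2 (π i)).2 x
    rwa [(h1 i).1] at this
  let K : Fin (m + 3) → X ≃ₜ X := fun i =>
    { toFun := k i
      invFun := k' (π i)
      left_inv := (h1 i).2
      right_inv := hr i
      continuous_toFun := S.k_cont h i
      continuous_invFun := S.k_cont h' _ }
  have hK : ∀ i, K i ∈ S.B := by
    intro i
    change k i S.b = S.b
    apply S.inj (π i)
    rw [← h, S.fb, S.fb, hg]
  refine ⟨P, fun i => ⟨K i, hK i⟩, S.hext fun i x => ?_⟩
  rw [wr_f, h]
  rfl

/-! ### The involution exchanging two neighbouring branch points -/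

lemma s01_a : S.sg (Equiv.swap 0 1) S.a = S.b := by
  conv_lhs => rw [← S.f0a]
  rw [sg_f, Equiv.swap_apply_left, S.f1a]
lemma s01_b : S.sg (Equiv.swap 0 1) S.b = S.a := by
  rw [← S.f1a, sg_f, Equiv.swap_apply_right, S.f0a]
lemma sg_c (π : Equiv.Perm (Fin (m + 3))) : S.sg π S.c = S.c := by
  rw [← S.fb 0, sg_f, S.fb, S.fb]
lemma sg_inv01 (x : X) : S.sg (Equiv.swap 0 1) (S.sg (Equiv.swap 0 1) x) = x := by
  rw [← h_mul, ← map_mul, Equiv.swap_mul_self, map_one]; rfl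

/-- Pieces of the map on the zeroth cell. -/
noncomputable def r0F (i : Fin (m + 3)) (x : X) : X :=
  if i = 0 then S.f 1 x else if i = 1 then S.f 0 (S.f 1 (S.sg (Equiv.swap 0 1) x)) else S.f i x

lemma r0F_b (i : Fin (m + 3)) : S.r0F i S.b = S.c := by
  unfold r0F
  split_ifs
  · exact S.fb 1
  · rw [S.s01_b, S.f1a, S.fb]
  · exact S.fb i

/-- The map on the zeroth cell. -/
noncomputable def r0 : X → X := S.glue S.r0F

lemma r0_f (i : Fin (m + 3)) (x : X) : S.r0 (S.f i x) = S.r0F i x :=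
  S.glue_f _ (fun i j => by rw [r0F_b, r0F_b]) i x

lemma r0_cont : Continuous S.r0 := by
  apply S.glue_cont _ (fun i j => by rw [r0F_b, r0F_b])
  intro i
  unfold r0F
  split_ifs
  · exact S.cont 1
  · exact (S.cont 0).comp ((S.cont 1).comp (Homeomorph.continuous _))
  · exact S.cont i

/-- Pieces of the involution. -/
noncomputable def rhF (i : Fin (m + 3)) (x : X) : X :=
  if i = 0 then S.r0 x else if i = 1 then S.f 0 (S.f 0 x) else S.f 0 (S.f i x)

lemma rhF_b (i : Fin (m + 3)) : S.rhF i S.b = S.f 0 S.c := by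
  unfold rhF
  split_ifs
  · rw [← S.f1a, r0_f]
    simp only [r0F, n01.symm, if_false, if_true]
    rw [S.s01_a, S.fb]
  · rw [S.fb]
  · rw [S.fb]

/-- The underlying function of the involution. -/
noncomputable def rh : X → X := S.glue S.rhF

lemma rh_f (i : Fin (m + 3)) (x : X) : S.rh (S.f i x) = S.rhF i x :=
  S.glue_f _ (fun i j => by rw [rhF_b, rhF_b]) i x

lemma rh_cont : Continuous S.rh := by
  apply S.glue_cont _ (fun i j => by rw [rhF_b, rhF_b])
  intro i
  unfold rhF
  split_ifs
  · exact S.r0_cont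
  · exact (S.cont 0).comp (S.cont 0)
  · exact (S.cont 0).comp (S.cont i)

lemma rh_00 (x : X) : S.rh (S.f 0 (S.f 0 x)) = S.f 1 x := by
  rw [rh_f]; simp only [rhF, if_true]; rw [r0_f]; simp only [r0F, if_true]
lemma rh_01 (x : X) : S.rh (S.f 0 (S.f 1 x)) = S.f 0 (S.f 1 (S.sg (Equiv.swap 0 1) x)) := by
  rw [rh_f]; simp only [rhF, if_true]; rw [r0_f]; simp only [r0F, n01.symm, if_false, if_true]
lemma rh_0j {j : Fin (m + 3)} (h0 : j ≠ 0) (h1 : j ≠ 1) (x : X) :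
    S.rh (S.f 0 (S.f j x)) = S.f j x := by
  rw [rh_f]; simp only [rhF, if_true]; rw [r0_f]; simp only [r0F, h0, h1, if_false]
lemma rh_1 (x : X) : S.rh (S.f 1 x) = S.f 0 (S.f 0 x) := by
  rw [rh_f]; simp only [rhF, n01.symm, if_false, if_true]
lemma rh_j {j : Fin (m + 3)} (h0 : j ≠ 0) (h1 : j ≠ 1) (x : X) :
    S.rh (S.f j x) = S.f 0 (S.f j x) := by
  rw [rh_f]; simp only [rhF, h0, h1, if_false]

lemma rh_rh (x : X) : S.rh (S.rh x) = x := by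
  obtain ⟨i, y, rfl⟩ := S.cover x
  by_cases h0 : i = 0
  · subst h0
    obtain ⟨j, z, rfl⟩ := S.cover y
    by_cases hj : j = 0
    · subst hj; rw [rh_00, rh_1]
    by_cases hj1 : j = 1
    · subst hj1; rw [rh_01, rh_01, sg_inv01]
    rw [S.rh_0j hj hj1, S.rh_j hj hj1]
  by_cases h1 : i = 1
  · subst h1; rw [rh_1, rh_00]
  rw [S.rh_j h0 h1, S.rh_0j h0 h1]

/-- The involution. -/
noncomputable def ρ : X ≃ₜ X where
  toFun := S.rh
  invFun := S.rh
  left_inv := S.rh_rh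
  right_inv := S.rh_rh
  continuous_toFun := S.rh_cont
  continuous_invFun := S.rh_cont

lemma ρ_00 (x : X) : S.ρ (S.f 0 (S.f 0 x)) = S.f 1 x := S.rh_00 x
lemma ρ_01 (x : X) : S.ρ (S.f 0 (S.f 1 x)) = S.f 0 (S.f 1 (S.sg (Equiv.swap 0 1) x)) := S.rh_01 x
lemma ρ_0j {j : Fin (m + 3)} (h0 : j ≠ 0) (h1 : j ≠ 1) (x : X) :
    S.ρ (S.f 0 (S.f j x)) = S.f j x := S.rh_0j h0 h1 x
lemma ρ_1 (x : X) : S.ρ (S.f 1 x) = S.f 0 (S.f 0 x) := S.rh_1 x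
lemma ρ_j {j : Fin (m + 3)} (h0 : j ≠ 0) (h1 : j ≠ 1) (x : X) :
    S.ρ (S.f j x) = S.f 0 (S.f j x) := S.rh_j h0 h1 x
lemma ρ_inv : S.ρ⁻¹ = S.ρ := rfl
lemma ρ_0c : S.ρ (S.f 0 S.c) = S.c := by
  rw [← S.fb 0, ρ_00, S.fb, S.fb]
lemma ρ_b : S.ρ S.b = S.a := by
  rw [← S.f1a, ρ_1, S.f0a, S.f0a]

/-- The translation. -/
noncomputable def t : X ≃ₜ X := S.sg (Equiv.swap 0 1) * S.ρ

lemma t_1 (x : X) : S.t (S.f 1 x) = S.f 1 (S.f 0 x) := by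
  rw [t, h_mul, ρ_1, sg_f, Equiv.swap_apply_left]
lemma t_j {j : Fin (m + 3)} (h0 : j ≠ 0) (h1 : j ≠ 1) (x : X) :
    S.t (S.f j x) = S.f 1 (S.f j x) := by
  rw [t, h_mul, S.ρ_j h0 h1, sg_f, Equiv.swap_apply_left]
lemma t_inv : S.t⁻¹ = S.ρ * S.sg (Equiv.swap 0 1) := by
  rw [t, mul_inv_rev, ρ_inv, ← map_inv, Equiv.swap_inv]
lemma ti_0 (x : X) : S.t⁻¹ (S.f 0 x) = S.f 0 (S.f 0 x) := by
  rw [t_inv, h_mul, sg_f, Equiv.swap_apply_left, ρ_1]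
lemma ti_1 (x : X) : S.t⁻¹ (S.f 1 x) = S.ρ (S.f 0 x) := by
  rw [t_inv, h_mul, sg_f, Equiv.swap_apply_right]
lemma ti_j {j : Fin (m + 3)} (h0 : j ≠ 0) (h1 : j ≠ 1) (x : X) :
    S.t⁻¹ (S.f j x) = S.f 0 (S.f j x) := by
  rw [t_inv, h_mul, sg_f, Equiv.swap_apply_of_ne_of_ne h0 h1, S.ρ_j h0 h1]
lemma t_b : S.t S.b = S.b := by
  rw [t, h_mul, ρ_b, s01_a]
lemma t_0c : S.t (S.f 0 S.c) = S.c := by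
  rw [t, h_mul, ρ_0c, sg_c]

end SelfSim

namespace SelfSim

variable {m : ℕ} {X : Type} [MetricSpace X] [CompactSpace X] (S : SelfSim m X)

lemma sg_b {π : Equiv.Perm (Fin (m + 3))} (h : π 1 = 1) : S.sg π S.b = S.b := by
  rw [← S.f1a, sg_f, h]

lemma ex_b {i : Fin (m + 3)} (h : i ≠ 1) (g : S.B) : S.ex i g S.b = S.b := by
  rw [← S.f1a, S.ex_ne h.symm]

lemma f_fw (i : Fin (m + 3)) (w : List (Fin (m + 3))) (x : X) :
    S.f i (S.fw w x) = S.fw (i :: w) x := rfl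

lemma sg_fw (π : Equiv.Perm (Fin (m + 3))) (w : List (Fin (m + 3))) :
    ∃ v : List (Fin (m + 3)), v.length = w.length ∧ S.sg π (S.fw w S.c) = S.fw v S.c := by
  cases w with
  | nil => exact ⟨[], rfl, S.sg_c π⟩
  | cons i w => exact ⟨π i :: w, rfl, S.sg_f π i _⟩

/-- Generating hypotheses for a subgroup. -/
structure Gen (Γ : Subgroup (X ≃ₜ X)) : Prop where
  sg_mem : ∀ π, S.sg π ∈ Γ
  rho_mem : S.ρ ∈ Γ
  ex_mem : ∀ g, S.ex 2 g ∈ Γ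

variable {S}

lemma Gen.t_mem {Γ : Subgroup (X ≃ₜ X)} (h : S.Gen Γ) : S.t ∈ Γ :=
  Γ.mul_mem (h.sg_mem _) h.rho_mem

lemma ex_conj (i : Fin (m + 3)) (g : S.B) :
    S.ex i g = S.sg (Equiv.swap 2 i) * S.ex 2 g * (S.sg (Equiv.swap 2 i))⁻¹ := by
  rw [eq_mul_inv_iff_mul_eq]
  apply S.hext
  intro j x
  rw [h_mul, h_mul, sg_f]
  by_cases hj : j = 2
  · subst hj
    rw [Equiv.swap_apply_left, ex_f, ex_f, sg_f, Equiv.swap_apply_left]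
  · rw [S.ex_ne hj, sg_f, S.ex_ne]
    intro h
    apply hj
    rw [← Equiv.swap_apply_left 2 i] at h
    exact (Equiv.swap 2 i).injective h

lemma Gen.ex_mem' {Γ : Subgroup (X ≃ₜ X)} (h : S.Gen Γ) (i : Fin (m + 3)) (g : S.B) :
    S.ex i g ∈ Γ := by
  rw [ex_conj]
  exact Γ.mul_mem (Γ.mul_mem (h.sg_mem _) (h.ex_mem _)) (Γ.inv_mem (h.sg_mem _))

lemma ws_mem {Γ : Subgroup (X ≃ₜ X)} (h : ∀ i g, S.ex i g ∈ Γ) (k : Fin (m + 3) → S.B) :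
    S.ws k ∈ Γ := by
  have : k ∈ Γ.comap S.ws := by
    apply Subgroup.pi_mem_of_mulSingle_mem
    intro i
    exact h i (k i)
  exact this

lemma stab_mem {Γ : Subgroup (X ≃ₜ X)} (h1 : ∀ π, S.sg π ∈ Γ) (h : ∀ i g, S.ex i g ∈ Γ)
    {g : X ≃ₜ X} (hg : g S.c = S.c) : g ∈ Γ := by
  obtain ⟨π, k, rfl⟩ := S.stab_c hg
  rw [wr_eq]
  exact Γ.mul_mem (h1 _) (ws_mem h _)

lemma Gen.trans {Γ : Subgroup (X ≃ₜ X)} (h : S.Gen Γ) (n : ℕ) :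
    ∀ w : List (Fin (m + 3)), w.length ≤ n → ∃ γ ∈ Γ, γ S.b = S.b ∧ γ (S.fw w S.c) = S.c := by
  induction n with
  | zero =>
    intro w hw
    rw [List.length_eq_zero_iff.mp (Nat.le_zero.mp hw)]
    exact ⟨1, Γ.one_mem, rfl, rfl⟩
  | succ n ih =>
    have h0 : ∀ w : List (Fin (m + 3)), w.length ≤ n → ∃ γ ∈ Γ, γ S.b = S.b ∧
        γ (S.fw (0 :: w) S.c) = S.c := by
      intro w hw
      obtain ⟨γ, hγ, hb, hc⟩ := ih w hw
      refine ⟨S.t * S.ex 0 ⟨γ, hb⟩, Γ.mul_mem h.t_mem (h.ex_mem' _ _), ?_, ?_⟩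
      · rw [h_mul, S.ex_b n01, t_b]
      · rw [h_mul, ← f_fw, ex_f, hc, t_0c]
    intro w hw
    match w, hw with
    | [], _ => exact ⟨1, Γ.one_mem, rfl, rfl⟩
    | i :: w, hw =>
      have hw' : w.length ≤ n := by simpa using hw
      by_cases hi0 : i = 0
      · subst hi0; exact h0 w hw'
      by_cases hi1 : i = 1
      · subst hi1
        have htb : S.t⁻¹ S.b = S.b := h_inv_eq S.t_b
        have red : ∀ v : List (Fin (m + 3)), S.t⁻¹ (S.fw (1 :: w) S.c) = S.fw v S.c →
            (∃ γ ∈ Γ, γ S.b = S.b ∧ γ (S.fw v S.c) = S.c) →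
            ∃ γ ∈ Γ, γ S.b = S.b ∧ γ (S.fw (1 :: w) S.c) = S.c := by
          rintro v hv ⟨γ, hγ, hb, hc⟩
          refine ⟨γ * S.t⁻¹, Γ.mul_mem hγ (Γ.inv_mem h.t_mem), ?_, ?_⟩
          · rw [h_mul, htb, hb]
          · rw [h_mul, hv, hc]
        match w, hw' with
        | [], _ =>
          apply red []
          · rw [← f_fw, ti_1]; exact S.ρ_0c
          · exact ih [] (by simp)
        | j :: w, hw' =>
          have hw2 : w.length + 1 ≤ n := by simpa using hw'
          by_cases hj0 : j = 0
          · subst hj0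
            apply red (1 :: w)
            · rw [← f_fw, ti_1, ← f_fw, ρ_00]; rfl
            · exact ih _ (by simpa using hw2)
          by_cases hj1 : j = 1
          · subst hj1
            obtain ⟨v, hv, hv'⟩ := S.sg_fw (Equiv.swap 0 1) w
            apply red (0 :: 1 :: v)
            · rw [← f_fw, ti_1, ← f_fw, ρ_01, hv']; rfl
            · exact h0 _ (by simp; omega)
          · apply red (j :: w)
            · rw [← f_fw, ti_1, ← f_fw, S.ρ_0j hj0 hj1]
            · exact ih _ (by simpa using hw2)
      · obtain ⟨γ, hγ, hb, hc⟩ := ih w hw'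
        refine ⟨S.t * (S.sg (Equiv.swap 0 i) * S.ex i ⟨γ, hb⟩),
          Γ.mul_mem h.t_mem (Γ.mul_mem (h.sg_mem _) (h.ex_mem' _ _)), ?_, ?_⟩
        · rw [h_mul, h_mul, S.ex_b hi1, S.sg_b, t_b]
          exact Equiv.swap_apply_of_ne_of_ne n01.symm (Ne.symm hi1)
        · rw [h_mul, h_mul, ← f_fw, ex_f, hc, sg_f, Equiv.swap_apply_right, t_0c]

lemma gen_top : S.Gen ⊤ := ⟨fun _ => trivial, trivial, fun _ => trivial⟩

lemma order_Br {p : X} (hp : p ∈ S.Br) : ptOrder X p = m + 3 := by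
  obtain ⟨w, rfl⟩ := hp
  obtain ⟨γ, _, _, h⟩ := (gen_top (S := S)).trans w.length w le_rfl
  rw [← order_homeo γ, h, S.order_c]

variable (S)
lemma wazewski (S : SelfSim m X) : IsWazewskiDendrite (m + 3) X := by
  refine ⟨S.dendrite, fun p => ?_, fun A hA => ?_⟩
  · by_cases hp : p ∈ S.Br
    · exact Or.inr (Or.inr (order_Br hp))
    · rcases S.order_other hp with h | h
      · exact Or.inl h
      · exact Or.inr (Or.inl h)
  · obtain ⟨e⟩ := hA
    obtain ⟨p, hp, hb⟩ := S.arc_br A e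
    exact ⟨p, hp, order_Br hb⟩
variable {S}

lemma Gen.eq_top {Γ : Subgroup (X ≃ₜ X)} (hΓ : S.Gen Γ) : Γ = ⊤ := by
  rw [eq_top_iff]
  intro h _
  have hb : h S.c ∈ S.Br := by
    by_contra hn
    have h1 := order_homeo h S.c
    rw [S.order_c] at h1
    rcases S.order_other hn with h2 | h2 <;> omega
  obtain ⟨w, hw⟩ := hb
  obtain ⟨γ, hγ, _, hc⟩ := hΓ.trans w.length w le_rfl
  have h3 : γ * h ∈ Γ := by
    apply stab_mem hΓ.sg_mem hΓ.ex_mem'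
    rw [h_mul, hw, hc]
  exact (Γ.mul_mem_cancel_left hγ).mp h3

/-! ### Infinite shift products -/

variable (S)

/-- The translates of the second cell. -/
noncomputable def V (k : ℤ) (x : X) : X := (S.t ^ k) (S.f 2 x)

lemma t_V (l k : ℤ) (x : X) : (S.t ^ l) (S.V k x) = S.V (l + k) x := by
  rw [V, ← h_mul, ← zpow_add]; rfl

lemma V_zero (x : X) : S.V 0 x = S.f 2 x := by rw [V, zpow_zero]; rfl

lemma V_pos (k : ℕ) (x : X) : S.V (k + 1) x = S.f 1 (S.fw (List.replicate k 0 ++ [2]) x) := by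
  induction k with
  | zero =>
    rw [V]
    simp only [Nat.cast_zero, zero_add, zpow_one]
    rw [S.t_j n02.symm n12.symm]; rfl
  | succ k ih =>
    have : ((k + 1 : ℕ) : ℤ) + 1 = 1 + (k + 1) := by push_cast; ring
    rw [this, ← t_V, ih, zpow_one, t_1]; rfl

lemma V_neg (k : ℕ) (x : X) : S.V (-k) x = S.fw (List.replicate k 0 ++ [2]) x := by
  induction k with
  | zero => simp only [Nat.cast_zero, neg_zero, V_zero]; rfl
  | succ k ih =>
    have : -((k + 1 : ℕ) : ℤ) = -1 + (-k) := by push_cast; ring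
    rw [this, ← t_V, ih, zpow_neg_one]
    cases k with
    | zero => exact S.ti_j n02.symm n12.symm x
    | succ k => exact S.ti_0 _

lemma V_word (k : ℤ) : ∃ w : List (Fin (m + 3)), k.natAbs ≤ w.length ∧ ∀ x, S.V k x = S.fw w x := by
  rcases le_or_gt k 0 with h | h
  · obtain ⟨n, rfl⟩ := Int.exists_eq_neg_ofNat h
    exact ⟨_, by simp, S.V_neg n⟩
  · obtain ⟨n, hn⟩ := Int.eq_succ_of_zero_lt h
    refine ⟨1 :: (List.replicate n 0 ++ [2]), by rw [hn]; simp; omega, fun x => ?_⟩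
    rw [hn]; exact S.V_pos n x

lemma V_ne_aux {k : ℕ} {x y : X} (h : S.V (k + 1) y = S.V 0 x) : False := by
  rw [V_pos, V_zero] at h
  have h1 := (S.inter_c n12 h).1
  cases k with
  | zero =>
    rw [← S.f1a] at h1
    exact S.ab (S.inter_c n12.symm h1).2
  | succ k =>
    rw [← S.f1a] at h1
    have h2 : S.f 0 (S.fw (List.replicate k 0 ++ [2]) y) = S.f 1 S.a := h1
    exact S.ab (S.inter_c n01 h2).2

lemma V_lt {k l : ℤ} (hkl : k < l) {x y : X} (h : S.V k x = S.V l y) : False := by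
  obtain ⟨n, hn⟩ := Int.eq_succ_of_zero_lt (sub_pos.mpr hkl)
  apply S.V_ne_aux (k := n) (x := x) (y := y)
  have h2 := congrArg (S.t ^ (-k)) h
  rw [t_V, t_V, neg_add_cancel] at h2
  rw [h2]
  congr 1
  omega

lemma V_inj {k l : ℤ} {x y : X} (h : S.V k x = S.V l y) : k = l ∧ x = y := by
  have hk : k = l := by
    rcases lt_trichotomy k l with h1 | h1 | h1
    · exact (S.V_lt h1 h).elim
    · exact h1
    · exact (S.V_lt h1 h.symm).elim
  subst hk
  exact ⟨rfl, S.inj 2 ((S.t ^ k).injective h)⟩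

open Classical in
/-- The infinite product of translates, as a function. -/
noncomputable def sf (d : ℤ → S.B) (p : X) : X :=
  if h : ∃ q : ℤ × X, p = S.V q.1 q.2 then
    S.V h.choose.1 ((d h.choose.1 : X ≃ₜ X) h.choose.2) else p

lemma sf_V (d : ℤ → S.B) (k : ℤ) (x : X) : S.sf d (S.V k x) = S.V k ((d k : X ≃ₜ X) x) := by
  have h : ∃ q : ℤ × X, S.V k x = S.V q.1 q.2 := ⟨(k, x), rfl⟩
  unfold sf
  rw [dif_pos h]
  obtain ⟨h1, h2⟩ := S.V_inj h.choose_spec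
  rw [← h1, ← h2]

lemma sf_off (d : ℤ → S.B) {p : X} (h : ¬ ∃ q : ℤ × X, p = S.V q.1 q.2) : S.sf d p = p := by
  unfold sf
  rw [dif_neg h]

lemma sf_mul (d d' : ℤ → S.B) (p : X) : S.sf (d * d') p = S.sf d (S.sf d' p) := by
  by_cases h : ∃ q : ℤ × X, p = S.V q.1 q.2
  · obtain ⟨⟨k, x⟩, rfl⟩ := h
    rw [sf_V, sf_V, sf_V]; rfl
  · rw [S.sf_off _ h, S.sf_off _ h, S.sf_off _ h]

lemma sf_one (p : X) : S.sf 1 p = p := by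
  by_cases h : ∃ q : ℤ × X, p = S.V q.1 q.2
  · obtain ⟨⟨k, x⟩, rfl⟩ := h
    rw [sf_V]; rfl
  · rw [S.sf_off _ h]

lemma sf_single (k : ℤ) (g : S.B) (p : X) :
    S.sf (Pi.mulSingle k g) p = (S.t ^ k) (S.ex 2 g ((S.t ^ (-k)) p)) := by
  by_cases h : ∃ q : ℤ × X, p = S.V q.1 q.2
  · obtain ⟨⟨l, x⟩, rfl⟩ := h
    dsimp only
    rw [sf_V, t_V]
    by_cases hl : l = k
    · subst hl
      rw [neg_add_cancel, V_zero, ex_f, Pi.mulSingle_eq_same]; rfl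
    · rw [Pi.mulSingle_eq_of_ne hl, S.ex_off, t_V, add_neg_cancel_left]; rfl
      intro y hy
      rw [← V_zero] at hy
      have := (S.V_inj hy).1
      omega
  · rw [S.sf_off _ h, S.ex_off, ← h_mul, ← zpow_add, add_neg_cancel, zpow_zero]; rfl
    intro y hy
    apply h
    refine ⟨(k, y), ?_⟩
    dsimp only
    rw [V, ← hy, ← h_mul, ← zpow_add, add_neg_cancel, zpow_zero]; rfl

lemma sf_close {ε : ℝ} (hε : 0 < ε) : ∃ N : ℕ, ∀ d d' : ℤ → S.B,
    (∀ k : ℤ, k.natAbs < N → d k = d' k) → ∀ p, dist (S.sf d p) (S.sf d' p) < ε := by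
  obtain ⟨N, hN⟩ := S.small hε
  refine ⟨N, fun d d' hd p => ?_⟩
  by_cases h : ∃ q : ℤ × X, p = S.V q.1 q.2
  · obtain ⟨⟨k, x⟩, rfl⟩ := h
    rw [sf_V, sf_V]
    dsimp only
    by_cases hk : k.natAbs < N
    · rw [hd k hk, dist_self]; exact hε
    · obtain ⟨w, hw, hw'⟩ := S.V_word k
      rw [hw', hw']
      exact hN w (by omega) _ _
  · rw [S.sf_off _ h, S.sf_off _ h, dist_self]; exact hε

lemma sf_fin_cont (d : ℤ → S.B) (s : Finset ℤ) :
    Continuous (S.sf (fun k => if k ∈ s then d k else 1)) := by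
  induction s using Finset.induction_on with
  | empty =>
    have : S.sf (fun k => if k ∈ (∅ : Finset ℤ) then d k else 1) = id := by
      funext p
      simp only [Finset.notMem_empty, if_false]
      exact S.sf_one p
    rw [this]; exact continuous_id
  | insert k s hk ih =>
    have h1 : (fun l => if l ∈ insert k s then d l else 1) =
        (Pi.mulSingle k (d k) : ℤ → S.B) * (fun l => if l ∈ s then d l else 1) := by
      funext l
      rw [Pi.mul_apply]
      by_cases hl : l = k
      · subst hl
        simp [hk]
      · rw [Pi.mulSingle_eq_of_ne hl]
        simp [hl]
    rw [h1]
    have h2 : S.sf ((Pi.mulSingle k (d k) : ℤ → S.B) * (fun l => if l ∈ s then d l else 1)) =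
        (fun p => (S.t ^ k) (S.ex 2 (d k) ((S.t ^ (-k)) p))) ∘
          S.sf (fun l => if l ∈ s then d l else 1) := by
      funext p
      rw [sf_mul, sf_single]; rfl
    rw [h2]
    exact ((S.t ^ k).continuous.comp ((S.ex 2 (d k)).continuous.comp
      (S.t ^ (-k)).continuous)).comp ih

lemma sf_cont (d : ℤ → S.B) : Continuous (S.sf d) := by
  apply continuous_of_uniform_approx_of_continuous
  intro u hu
  obtain ⟨ε, hε, hu⟩ := Metric.mem_uniformity_dist.mp hu
  obtain ⟨N, hN⟩ := S.sf_close hε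
  refine ⟨_, S.sf_fin_cont d (Finset.Icc (-N) N), fun y => ?_⟩
  apply hu
  apply hN
  intro k hk
  rw [if_pos]
  rw [Finset.mem_Icc]
  omega

/-- The infinite products, as a homomorphism. -/
noncomputable def sh : (ℤ → S.B) →* (X ≃ₜ X) where
  toFun d :=
    { toFun := S.sf d
      invFun := S.sf d⁻¹
      left_inv := fun p => by rw [← sf_mul, inv_mul_cancel, sf_one]
      right_inv := fun p => by rw [← sf_mul, mul_inv_cancel, sf_one]
      continuous_toFun := S.sf_cont d
      continuous_invFun := S.sf_cont d⁻¹ }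
  map_one' := Homeomorph.ext S.sf_one
  map_mul' d d' := Homeomorph.ext (S.sf_mul d d')

lemma sh_apply (d : ℤ → S.B) (p : X) : S.sh d p = S.sf d p := rfl

lemma sh_single (g : S.B) : S.sh (Pi.mulSingle 0 g) = S.ex 2 g := by
  apply Homeomorph.ext
  intro p
  rw [sh_apply, sf_single, neg_zero, zpow_zero]; rfl

lemma sh_conj (d : ℤ → S.B) (l : ℤ) :
    S.t ^ l * S.sh d * S.t ^ (-l) = S.sh (fun k => d (k - l)) := by
  apply Homeomorph.ext
  intro p
  rw [h_mul, h_mul, sh_apply, sh_apply]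
  by_cases h : ∃ q : ℤ × X, p = S.V q.1 q.2
  · obtain ⟨⟨k, x⟩, rfl⟩ := h
    dsimp only
    rw [t_V, sf_V, t_V, sf_V, add_neg_cancel_left, neg_add_eq_sub]
  · rw [S.sf_off _ h, S.sf_off, ← h_mul, ← zpow_add, add_neg_cancel, zpow_zero]; rfl
    rintro ⟨⟨k, y⟩, hy⟩
    apply h
    refine ⟨(l + k, y), ?_⟩
    dsimp only at hy ⊢
    rw [← t_V, ← hy, ← h_mul, ← zpow_add, add_neg_cancel, zpow_zero]; rfl

lemma ex_comm (g : S.B) : S.ex 2 g ∈ commutator (X ≃ₜ X) := by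
  have hc : ∀ u v : X ≃ₜ X, u * v * u⁻¹ * v⁻¹ ∈ commutator (X ≃ₜ X) := fun u v =>
    Subgroup.commutator_mem_commutator (Subgroup.mem_top u) (Subgroup.mem_top v)
  let d : ℤ → S.B := fun k => if 0 ≤ k then g else 1
  have h1 : S.ex 2 g = S.sh d * S.t * (S.sh d)⁻¹ * S.t⁻¹ := by
    have h2 := S.sh_conj d⁻¹ 1
    rw [map_inv, zpow_one, zpow_neg_one] at h2
    rw [mul_assoc, mul_assoc, ← mul_assoc S.t, h2, ← map_mul, ← sh_single]
    congr 1
    funext k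
    rw [Pi.mul_apply]
    by_cases hk : k = 0
    · subst hk; simp [d]
    · rw [Pi.mulSingle_eq_of_ne hk]
      simp only [d, Pi.inv_apply]
      by_cases h : 0 ≤ k
      · rw [if_pos h, if_pos (by omega), mul_inv_cancel]
      · rw [if_neg h, if_neg (by omega), inv_one, mul_one]
  rw [h1]
  exact hc _ _

lemma conj_swap12 (hb : S.sg (Equiv.swap 0 2) ∈ S.B) :
    S.ρ * S.sg (Equiv.swap 1 2) * S.ρ⁻¹ = S.ex 0 ⟨S.sg (Equiv.swap 0 2), hb⟩ := by
  rw [ρ_inv]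
  apply S.hext
  intro i x
  rw [h_mul, h_mul]
  by_cases h0 : i = 0
  · subst h0
    rw [ex_f]
    obtain ⟨j, z, rfl⟩ := S.cover x
    dsimp only
    rw [sg_f]
    by_cases hj0 : j = 0
    · subst hj0
      rw [ρ_00, sg_f, Equiv.swap_apply_left, Equiv.swap_apply_left, S.ρ_j n02.symm n12.symm]
    by_cases hj1 : j = 1
    · subst hj1
      rw [ρ_01, sg_f, Equiv.swap_apply_of_ne_of_ne n01 n02, ρ_01, sg_inv01,
        Equiv.swap_apply_of_ne_of_ne n01.symm n12]
    by_cases hj2 : j = 2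
    · subst hj2
      rw [S.ρ_0j hj0 hj1, sg_f, Equiv.swap_apply_right, Equiv.swap_apply_right, ρ_1]
    · rw [S.ρ_0j hj0 hj1, sg_f, Equiv.swap_apply_of_ne_of_ne hj1 hj2, S.ρ_j hj0 hj1,
        Equiv.swap_apply_of_ne_of_ne hj0 hj2]
  · rw [S.ex_ne h0]
    by_cases h1 : i = 1
    · subst h1
      rw [ρ_1, sg_f, Equiv.swap_apply_of_ne_of_ne n01 n02, ρ_00]
    · rw [S.ρ_j h0 h1, sg_f, Equiv.swap_apply_of_ne_of_ne n01 n02, S.ρ_0j h0 h1]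

lemma ex_comm' (i : Fin (m + 3)) (g : S.B) : S.ex i g ∈ commutator (X ≃ₜ X) := by
  rw [ex_conj]
  exact Subgroup.Normal.conj_mem inferInstance _ (S.ex_comm g) _

lemma sg_comm (π : Equiv.Perm (Fin (m + 3))) : S.sg π ∈ commutator (X ≃ₜ X) := by
  have hb : S.sg (Equiv.swap 0 2) ∈ S.B :=
    S.sg_b (Equiv.swap_apply_of_ne_of_ne n01.symm n12)
  have h12 : S.sg (Equiv.swap 1 2) ∈ commutator (X ≃ₜ X) := by
    have h := Subgroup.Normal.conj_mem (H := commutator (X ≃ₜ X)) inferInstance _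
      (S.ex_comm' 0 ⟨_, hb⟩) S.ρ⁻¹
    rw [← S.conj_swap12 hb] at h
    have e : S.ρ⁻¹ * (S.ρ * S.sg (Equiv.swap 1 2) * S.ρ⁻¹) * S.ρ⁻¹⁻¹ = S.sg (Equiv.swap 1 2) := by
      group
    rwa [e] at h
  have hle : (⊤ : Subgroup (Equiv.Perm (Fin (m + 3)))) ≤ (commutator (X ≃ₜ X)).comap S.sg := by
    rw [← Equiv.Perm.closure_isSwap, Subgroup.closure_le]
    rintro σ ⟨i, j, hij, rfl⟩
    obtain ⟨τ, hτ⟩ := isConj_iff.mp (Equiv.Perm.isConj_swap (n12 (m := m)) hij)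
    change S.sg _ ∈ commutator (X ≃ₜ X)
    rw [← hτ, map_mul, map_mul, map_inv]
    exact Subgroup.Normal.conj_mem inferInstance _ h12 _
  exact hle trivial

lemma perfect (S : SelfSim m X) : commutator (X ≃ₜ X) = ⊤ := by
  apply Gen.eq_top (S := S)
  refine ⟨S.sg_comm, ?_, S.ex_comm⟩
  obtain ⟨γ, _, _, hc⟩ := (gen_top (S := S)).trans 2 [0, 1] (by simp)
  have hf : S.ρ (S.fw [0, 1] S.c) = S.fw [0, 1] S.c := by
    change S.ρ (S.f 0 (S.f 1 S.c)) = _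
    rw [ρ_01, sg_c]; rfl
  have h1 : γ * S.ρ * γ⁻¹ ∈ commutator (X ≃ₜ X) := by
    apply stab_mem S.sg_comm S.ex_comm'
    rw [h_mul, h_mul, h_inv_eq hc, hf, hc]
  have h := Subgroup.Normal.conj_mem (H := commutator (X ≃ₜ X)) inferInstance _ h1 γ⁻¹
  have e : γ⁻¹ * (γ * S.ρ * γ⁻¹) * γ⁻¹⁻¹ = S.ρ := by group
  rwa [e] at h

end SelfSim

namespace SelfSim

variable {m : ℕ} {X : Type} [MetricSpace X] [CompactSpace X] (S : SelfSim m X)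

/-- The forgetful map to continuous maps. -/
def toC (h : X ≃ₜ X) : C(X, X) := (h : C(X, X))

lemma toC_ind : IsInducing (toC : (X ≃ₜ X) → C(X, X)) := ⟨rfl⟩

lemma cont_mul : Continuous fun p : (X ≃ₜ X) × (X ≃ₜ X) => p.1 * p.2 := by
  rw [toC_ind.continuous_iff]
  have : toC ∘ (fun p : (X ≃ₜ X) × (X ≃ₜ X) => p.1 * p.2) =
      fun p => (toC p.1).comp (toC p.2) := by
    funext p; rfl
  rw [this]
  exact (toC_ind.continuous.comp continuous_fst).compCM (toC_ind.continuous.comp continuous_snd)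

lemma cont_inv : Continuous fun p : X ≃ₜ X => p⁻¹ := by
  rw [toC_ind.continuous_iff, ContinuousMap.continuous_compactOpen]
  intro K hK U hU
  have : {x : X ≃ₜ X | Set.MapsTo ((toC ∘ fun p : X ≃ₜ X => p⁻¹) x) K U} =
      toC ⁻¹' {x : C(X, X) | Set.MapsTo x Uᶜ Kᶜ} := by
    ext g
    constructor
    · intro h y hy hk
      apply hy
      have := h hk
      change g⁻¹ (g y) ∈ U at this
      rwa [h_inv_apply] at this
    · intro h y hy
      by_contra hn
      apply h hn
      change g (g⁻¹ y) ∈ K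
      rwa [h_apply_inv]
  rw [this]
  exact (ContinuousMap.isOpen_setOfPred_mapsTo hU.isClosed_compl.isCompact
    hK.isClosed.isOpen_compl).preimage toC_ind.continuous

instance topGroup : IsTopologicalGroup (X ≃ₜ X) where
  continuous_mul := cont_mul
  continuous_inv := cont_inv

instance secCount : SecondCountableTopology (X ≃ₜ X) :=
  toC_ind.secondCountableTopology

lemma mem_closure_of {A : Set (X ≃ₜ X)} {h : X ≃ₜ X}
    (H : ∀ ε > 0, ∃ g ∈ A, ∀ x, dist (g x) (h x) < ε) : h ∈ closure A := by
  rw [toC_ind.closure_eq_preimage_closure_image, Set.mem_preimage, Metric.mem_closure_iff]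
  intro ε hε
  obtain ⟨g, hg, hd⟩ := H ε hε
  refine ⟨toC g, ⟨g, hg, rfl⟩, ?_⟩
  rw [ContinuousMap.dist_lt_iff hε]
  intro x
  rw [dist_comm]
  exact hd x

/-- A sequence dense in the range of the extension map. -/
lemma dense_seq : ∃ e : ℕ → S.B, ∀ g : S.B, S.ex 2 g ∈ closure (Set.range fun j => S.ex 2 (e j)) := by
  have : Nonempty (Set.range (S.ex 2)) := ⟨⟨_, 1, rfl⟩⟩
  obtain ⟨u, hu⟩ := TopologicalSpace.exists_dense_seq (Set.range (S.ex 2))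
  choose e he using fun j => (u j).2
  refine ⟨e, fun g => ?_⟩
  have h := hu ⟨S.ex 2 g, g, rfl⟩
  rw [closure_subtype] at h
  have e2 : (fun j => S.ex 2 (e j)) = fun j => (u j : X ≃ₜ X) := funext he
  rw [e2]
  rw [← Set.range_comp] at h
  exact h

/-- The sparse sequence. -/
noncomputable def sp (e : ℕ → S.B) (p : ℤ) : S.B :=
  open Classical in if h : ∃ k : ℕ, p = 2 ^ k then e (Nat.unpair h.choose).1 else 1

lemma sp_pow (e : ℕ → S.B) (k : ℕ) : S.sp e (2 ^ k) = e (Nat.unpair k).1 := by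
  have h : ∃ l : ℕ, (2 : ℤ) ^ k = 2 ^ l := ⟨k, rfl⟩
  unfold sp
  rw [dif_pos h]
  have h2 := h.choose_spec
  have : k = h.choose := by
    have h3 : (2 : ℕ) ^ k = 2 ^ h.choose := by exact_mod_cast h2
    exact Nat.pow_right_injective le_rfl h3
  rw [← this]

lemma sp_off (e : ℕ → S.B) {p : ℤ} (h : ¬ ∃ k : ℕ, p = 2 ^ k) : S.sp e p = 1 := by
  unfold sp
  rw [dif_neg h]

lemma sp_near (e : ℕ → S.B) {k : ℕ} {l : ℤ} (hl : l ≠ 0) (hk : l.natAbs < 2 ^ (k - 1)) (hk1 : 1 ≤ k) :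
    S.sp e (l + 2 ^ k) = 1 := by
  apply S.sp_off
  rintro ⟨j, hj⟩
  obtain ⟨k, rfl⟩ : ∃ k', k = k' + 1 := ⟨k - 1, by omega⟩
  rw [Nat.add_sub_cancel] at hk
  have hk' : |l| < 2 ^ k := by
    rw [Int.abs_eq_natAbs]; exact_mod_cast hk
  rw [abs_lt] at hk'
  rcases lt_trichotomy j (k + 1) with h | h | h
  · have : (2 : ℤ) ^ j ≤ 2 ^ k := pow_le_pow_right₀ (by norm_num) (by omega)
    rw [pow_succ] at hj
    linarith
  · subst h
    apply hl; linarith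
  · have : (2 : ℤ) ^ (k + 2) ≤ 2 ^ j := pow_le_pow_right₀ (by norm_num) (by omega)
    rw [pow_succ] at hj
    rw [pow_succ, pow_succ] at this
    linarith

lemma ex_closure (e : ℕ → S.B) (j : ℕ) (G : Subgroup (X ≃ₜ X)) (ht : S.t ∈ G)
    (hx : S.sh (S.sp e) ∈ G) : S.ex 2 (e j) ∈ closure (G : Set (X ≃ₜ X)) := by
  apply mem_closure_of
  intro ε hε
  obtain ⟨N, hN⟩ := S.sf_close hε
  let k := Nat.pair j (N + 1)
  have hk : N + 1 ≤ k := Nat.right_le_pair _ _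
  refine ⟨S.t ^ (-(2 ^ k) : ℤ) * S.sh (S.sp e) * S.t ^ (-(-(2 ^ k)) : ℤ),
    G.mul_mem (G.mul_mem (G.zpow_mem ht _) hx) (G.zpow_mem ht _), fun x => ?_⟩
  rw [S.sh_conj, ← sh_single, sh_apply, sh_apply]
  apply hN
  intro l hl
  rw [sub_neg_eq_add]
  by_cases h0 : l = 0
  · subst h0
    rw [zero_add, sp_pow, Pi.mulSingle_eq_same]
    simp [k]
  · rw [Pi.mulSingle_eq_of_ne h0]
    apply S.sp_near e h0 _ (by omega)
    have h1 : k - 1 < 2 ^ (k - 1) := Nat.lt_two_pow_self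
    omega

lemma main (S : SelfSim m X) : ∃ G : Subgroup (X ≃ₜ X),
      G.FG ∧ Dense ((⁅G, G⁆ : Subgroup (X ≃ₜ X)) : Set (X ≃ₜ X)) := by
  obtain ⟨e, he⟩ := S.dense_seq
  let A : Set (X ≃ₜ X) := Set.range S.sg ∪ {S.ρ, S.sh (S.sp e)}
  have hA : A.Finite := (Set.finite_range _).union (Set.toFinite _)
  let G := Subgroup.closure A
  have hsg : ∀ π, S.sg π ∈ G := fun π => Subgroup.subset_closure (Or.inl ⟨π, rfl⟩)
  have hρ : S.ρ ∈ G := Subgroup.subset_closure (Or.inr (Or.inl rfl))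
  have hx : S.sh (S.sp e) ∈ G := Subgroup.subset_closure (Or.inr (Or.inr rfl))
  have htop : G.topologicalClosure = ⊤ := by
    apply Gen.eq_top (S := S)
    refine ⟨fun π => G.le_topologicalClosure (hsg π), G.le_topologicalClosure hρ, fun g => ?_⟩
    have h1 : (Set.range fun j => S.ex 2 (e j)) ⊆ closure (G : Set (X ≃ₜ X)) := by
      rintro _ ⟨j, rfl⟩
      exact S.ex_closure e j G (G.mul_mem (hsg _) hρ) hx
    exact closure_minimal h1 isClosed_closure (he g)
  have hd : Dense (G : Set (X ≃ₜ X)) := by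
    intro g
    have : g ∈ G.topologicalClosure := by rw [htop]; trivial
    exact this
  refine ⟨G, (Subgroup.fg_iff _).mpr ⟨A, rfl, hA⟩, ?_⟩
  let N := (⁅G, G⁆ : Subgroup (X ≃ₜ X)).topologicalClosure
  have hN : IsClosed (N : Set (X ≃ₜ X)) := Subgroup.isClosed_topologicalClosure _
  have hall : ∀ u v : X ≃ₜ X, u * v * u⁻¹ * v⁻¹ ∈ N := by
    have hc : IsClosed {p : (X ≃ₜ X) × (X ≃ₜ X) | p.1 * p.2 * p.1⁻¹ * p.2⁻¹ ∈ (N : Set (X ≃ₜ X))} :=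
      hN.preimage (by fun_prop)
    have hsub : (G : Set (X ≃ₜ X)) ×ˢ (G : Set (X ≃ₜ X)) ⊆
        {p : (X ≃ₜ X) × (X ≃ₜ X) | p.1 * p.2 * p.1⁻¹ * p.2⁻¹ ∈ (N : Set (X ≃ₜ X))} := by
      rintro ⟨u, v⟩ ⟨hu, hv⟩
      exact Subgroup.le_topologicalClosure _ (Subgroup.commutator_mem_commutator hu hv)
    intro u v
    exact closure_minimal hsub hc ((hd.prod hd) (u, v))
  have htopN : N = ⊤ := by
    rw [eq_top_iff, ← S.perfect]
    exact Subgroup.commutator_le.mpr fun u _ v _ => hall u v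
  intro g
  have : g ∈ N := by rw [htopN]; trivial
  exact this

end SelfSim

theorem statement5 (n : ℕ) (hn : 3 ≤ n) :
    ∃ (X : Type) (_ : TopologicalSpace X) (_ : IsWazewskiDendrite n X)
      (G : Subgroup (X ≃ₜ X)),
      G.FG ∧ Dense ((⁅G, G⁆ : Subgroup (X ≃ₜ X)) : Set (X ≃ₜ X)) := by
  obtain ⟨m, rfl⟩ : ∃ m, n = m + 3 := ⟨n - 3, by omega⟩
  have : CompactSpace (Model.K m) := isCompact_iff_compactSpace.mp (Model.K_compact m)
  exact ⟨Model.K m, inferInstance, (Model.selfSim m).wazewski, (Model.selfSim m).main⟩
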